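/- Let d ≥ 2 and let Ω₁ ⊆ Ω₂ ⊂ ℝ^d be nonempty bounded convex open sets. Then μ₁(Ω₁) ≥ (π²/(4·j_{d/2−1,1}²))·μ₁(Ω₂), where j_{d/2−1,1} is the first positive zero of the Bessel function J_{d/2−1}. -/

import Mathlib

open MeasureTheory Real Filter

noncomputable section

/-- Euclidean space `ℝ^d`. -/
abbrev Euc (d : ℕ) := EuclideanSpace ℝ (Fin d)

/-- The Rayleigh quotient of a function `u` on a set `Ω ⊆ ℝ^d`. -/
noncomputable def rayleigh {d : ℕ} (Ω : Set (Euc d)) (u : Euc d → ℝ) : ℝ :=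
  (∫ x in Ω, ‖fderiv ℝ u x‖ ^ 2) / (∫ x in Ω, (u x) ^ 2)

/-- The `k`-th Neumann eigenvalue of `Ω ⊆ ℝ^d`, defined by the variational (min-max)
principle: the infimum, over all subspaces `V` of smooth functions `ℝ^d → ℝ` whose space of
restrictions to `Ω` is `(k+1)`-dimensional, of the supremum of the Rayleigh quotient over
the elements of `V` that are nonzero in `L²(Ω)`. -/
noncomputable def neumannEigenvalue {d : ℕ} (k : ℕ) (Ω : Set (Euc d)) : ℝ :=
  sInf { t : ℝ | ∃ V : Submodule ℝ (Euc d → ℝ),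
    (∀ u ∈ V, ContDiff ℝ (⊤ : ℕ∞) u) ∧
    Module.finrank ℝ (V.map (LinearMap.funLeft ℝ ℝ ((↑) : Ω → Euc d))) = k + 1 ∧
    t = sSup { r : ℝ | ∃ u ∈ V, (0 < ∫ x in Ω, (u x) ^ 2) ∧ r = rayleigh Ω u } }

/-- A nonempty bounded convex open subset of `ℝ^d`. -/
def IsConvexDomain {d : ℕ} (Ω : Set (Euc d)) : Prop :=
  Ω.Nonempty ∧ IsOpen Ω ∧ Bornology.IsBounded Ω ∧ Convex ℝ Ω

/-- The optimal constant `α_{k,d}`: the infimum of `μ_k(Ω₁)/μ_k(Ω₂)` over all pairs of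
nonempty bounded convex open sets `Ω₁ ⊆ Ω₂ ⊂ ℝ^d`. -/
noncomputable def alphaConst (k d : ℕ) : ℝ :=
  sInf { r : ℝ | ∃ Ω₁ Ω₂ : Set (Euc d), IsConvexDomain Ω₁ ∧ IsConvexDomain Ω₂ ∧ Ω₁ ⊆ Ω₂ ∧
    r = neumannEigenvalue k Ω₁ / neumannEigenvalue k Ω₂ }

/-- The Bessel function of the first kind of order `ν` (for `x > 0`). -/
noncomputable def besselJ (ν : ℝ) (x : ℝ) : ℝ :=
  ∑' m : ℕ, ((-1 : ℝ) ^ m / (m.factorial * Real.Gamma (m + ν + 1))) * (x / 2) ^ (2 * (m : ℝ) + ν)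

/-- The first positive zero `j_{ν,1}` of the Bessel function `J_ν`. -/
noncomputable def besselZero1 (ν : ℝ) : ℝ :=
  sInf {x : ℝ | 0 < x ∧ besselJ ν x = 0}

/-- The second positive zero `j_{ν,2}` of the Bessel function `J_ν`. -/
noncomputable def besselZero2 (ν : ℝ) : ℝ :=
  sInf {x : ℝ | besselZero1 ν < x ∧ besselJ ν x = 0}

open scoped ENNReal NNReal

lemma wirtinger_aux {a b k : ℝ} (hab : a < b) (hk0 : 0 < k) (hk : k * (b - a) < π)
    {w w' : ℝ → ℝ} (hw : ∀ t, HasDerivAt w (w' t) t) (hc : Continuous w')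
    (ha : w a = 0) (hb : w b = 0) :
    k ^ 2 * ∫ t in a..b, w t ^ 2 ≤ ∫ t in a..b, w' t ^ 2 := by
  have hwc : Continuous w := continuous_iff_continuousAt.2 fun t => (hw t).continuousAt
  set m := (a + b) / 2 with hm
  have hcos : ∀ t ∈ Set.uIcc a b, cos (k * (t - m)) ≠ 0 := by
    intro t ht
    rw [Set.uIcc_of_le hab.le] at ht
    apply ne_of_gt
    apply cos_pos_of_mem_Ioo
    constructor <;> nlinarith [ht.1, ht.2]
  have hd : ∀ t ∈ Set.uIcc a b, HasDerivAt (fun t => k * tan (k * (t - m)) * w t ^ 2)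
      ((w' t + k * tan (k * (t - m)) * w t) ^ 2 - w' t ^ 2 + k ^ 2 * w t ^ 2) t := by
    intro t ht
    have h1 : HasDerivAt (fun t => k * (t - m)) k t := by
      simpa using ((hasDerivAt_id t).sub_const m).const_mul k
    have h2 := (((hasDerivAt_tan (hcos t ht)).comp t h1).const_mul k).mul ((hw t).pow 2)
    refine h2.congr_deriv ?_
    simp only [Function.comp, tan_eq_sin_div_cos]
    have := hcos t ht
    field_simp
    have := sin_sq_add_cos_sq (k * (t - m))
    push_cast
    simp only [Pi.pow_apply]
    linear_combination (-(w t)^2*k^2) * this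
  have hcont : ContinuousOn (fun t => tan (k * (t - m))) (Set.uIcc a b) := by
    intro t ht
    have := (continuousAt_tan.2 (hcos t ht))
    exact (ContinuousAt.comp (f := fun t => k * (t - m)) this (by fun_prop)).continuousWithinAt
  have hi : IntervalIntegrable (fun t => (w' t + k * tan (k * (t - m)) * w t) ^ 2) volume a b := by
    apply ContinuousOn.intervalIntegrable
    fun_prop
  have hi2 : IntervalIntegrable (fun t => w' t ^ 2) volume a b := (by fun_prop : Continuous _).intervalIntegrable _ _
  have hi3 : IntervalIntegrable (fun t => k ^ 2 * w t ^ 2) volume a b := (by fun_prop : Continuous _).intervalIntegrable _ _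
  have := intervalIntegral.integral_eq_sub_of_hasDerivAt hd ((hi.sub hi2).add hi3)
  rw [intervalIntegral.integral_add (hi.sub hi2) hi3, intervalIntegral.integral_sub hi hi2, intervalIntegral.integral_const_mul] at this
  simp only [ha, hb] at this
  have hn : 0 ≤ ∫ t in a..b, (w' t + k * tan (k * (t - m)) * w t) ^ 2 :=
    intervalIntegral.integral_nonneg hab.le fun t _ => sq_nonneg _
  linarith

lemma wirtinger {a b : ℝ} (hab : a < b)
    {w w' : ℝ → ℝ} (hw : ∀ t, HasDerivAt w (w' t) t) (hc : Continuous w')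
    (ha : w a = 0) (hb : w b = 0) :
    (π / (b - a)) ^ 2 * ∫ t in a..b, w t ^ 2 ≤ ∫ t in a..b, w' t ^ 2 := by
  have hL : 0 < b - a := sub_pos.2 hab
  have hp : 0 < π / (b - a) := div_pos pi_pos hL
  have ht : Tendsto (fun k : ℝ => k ^ 2 * ∫ t in a..b, w t ^ 2) (nhdsWithin (π / (b - a)) (Set.Iio (π / (b - a))))
      (nhds ((π / (b - a)) ^ 2 * ∫ t in a..b, w t ^ 2)) :=
    ((by fun_prop : Continuous (fun k : ℝ => k ^ 2 * ∫ t in a..b, w t ^ 2)).tendsto _).mono_left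
      nhdsWithin_le_nhds
  refine le_of_tendsto ht ?_
  filter_upwards [Ioo_mem_nhdsLT hp] with k hk
  exact wirtinger_aux hab hk.1 ((lt_div_iff₀ hL).1 hk.2) hw hc ha hb

lemma weighted_dirichlet {a b : ℝ} (hab : a < b)
    {V V' V'' : ℝ → ℝ} (hV : ∀ t, HasDerivAt V (V' t) t) (hV' : ∀ t, HasDerivAt V' (V'' t) t)
    (hVc : Continuous V'') (hconv : ∀ t ∈ Set.Icc a b, 0 ≤ V'' t)
    {G G' : ℝ → ℝ} (hG : ∀ t, HasDerivAt G (G' t) t) (hc : Continuous G')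
    (ha : G a = 0) (hb : G b = 0) :
    (π / (b - a)) ^ 2 * ∫ t in a..b, G t ^ 2 * exp (V t) ≤ ∫ t in a..b, G' t ^ 2 * exp (V t) := by
  have hVc0 : Continuous V := continuous_iff_continuousAt.2 fun t => (hV t).continuousAt
  have hVc1 : Continuous V' := continuous_iff_continuousAt.2 fun t => (hV' t).continuousAt
  have hGc : Continuous G := continuous_iff_continuousAt.2 fun t => (hG t).continuousAt
  set w : ℝ → ℝ := fun t => G t * exp (V t / 2) with hw
  set w' : ℝ → ℝ := fun t => (G' t + G t * V' t / 2) * exp (V t / 2) with hw'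
  have hwd : ∀ t, HasDerivAt w (w' t) t := by
    intro t
    refine ((hG t).mul ((hV t).div_const 2).exp).congr_deriv ?_
    simp only [hw']; ring
  have hwc : Continuous w := by fun_prop
  have hw'c : Continuous w' := by fun_prop
  have h1 := wirtinger hab hwd hw'c (by simp [hw, ha]) (by simp [hw, hb])
  have hexp : ∀ t, exp (V t / 2) ^ 2 = exp (V t) := by
    intro t; rw [← exp_nat_mul]; congr 1; push_cast; ring
  have e1 : ∀ t, w t ^ 2 = G t ^ 2 * exp (V t) := by
    intro t; simp only [hw, mul_pow, hexp]
  have hd : ∀ t ∈ Set.uIcc a b, HasDerivAt (fun t => V' t * w t ^ 2)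
      (V'' t * w t ^ 2 + 2 * V' t * w t * w' t) t := by
    intro t _
    refine ((hV' t).mul ((hwd t).pow 2)).congr_deriv ?_
    simp only [Pi.pow_apply]
    push_cast; ring
  have h2 := intervalIntegral.integral_eq_sub_of_hasDerivAt hd
    ((by fun_prop : Continuous _).intervalIntegrable _ _)
  have hwa : w a = 0 := by simp [hw, ha]
  have hwb : w b = 0 := by simp [hw, hb]
  rw [hwa, hwb] at h2
  have e2 : ∀ t, G' t ^ 2 * exp (V t) = w' t ^ 2 + (V'' t * w t ^ 2 / 2 + V' t ^ 2 * w t ^ 2 / 4)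
      - (1 / 2) * (V'' t * w t ^ 2 + 2 * V' t * w t * w' t) := by
    intro t
    simp only [hw, hw', mul_pow, hexp]
    have := hexp t
    linear_combination (-(V' t * G t * (G' t + G t * V' t / 2))) * (-this)
  have h3 : ∫ t in a..b, G' t ^ 2 * exp (V t) = (∫ t in a..b, w' t ^ 2) +
      ∫ t in a..b, (V'' t * w t ^ 2 / 2 + V' t ^ 2 * w t ^ 2 / 4) := by
    simp_rw [e2]
    rw [intervalIntegral.integral_sub, intervalIntegral.integral_add,
      intervalIntegral.integral_const_mul, h2]
    · simp
    all_goals exact (by fun_prop : Continuous _).intervalIntegrable _ _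
  have h4 : 0 ≤ ∫ t in a..b, (V'' t * w t ^ 2 / 2 + V' t ^ 2 * w t ^ 2 / 4) := by
    apply intervalIntegral.integral_nonneg hab.le
    intro t ht
    have := hconv t ht
    positivity
  simp_rw [e1] at h1
  linarith

/-- Poincaré inequality for smooth log-concave weight. -/
lemma poincare_smooth {a b : ℝ} (hab : a < b)
    {V V' V'' : ℝ → ℝ} (hV : ∀ t, HasDerivAt V (V' t) t) (hV' : ∀ t, HasDerivAt V' (V'' t) t)
    (hVc : Continuous V'') (hconv : ∀ t ∈ Set.Icc a b, 0 ≤ V'' t)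
    {v v' : ℝ → ℝ} (hv : ∀ t, HasDerivAt v (v' t) t) (hc : Continuous v') :
    (π / (b - a)) ^ 2 * ((∫ t in a..b, v t ^ 2 * exp (-V t)) * (∫ t in a..b, exp (-V t))
      - (∫ t in a..b, v t * exp (-V t)) ^ 2) ≤
      (∫ t in a..b, v' t ^ 2 * exp (-V t)) * (∫ t in a..b, exp (-V t)) := by
  have hVc0 : Continuous V := continuous_iff_continuousAt.2 fun t => (hV t).continuousAt
  have hvc : Continuous v := continuous_iff_continuousAt.2 fun t => (hv t).continuousAt
  set P := ∫ t in a..b, exp (-V t) with hP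
  have hPpos : 0 < P := by
    apply intervalIntegral.intervalIntegral_pos_of_pos _ (fun t => exp_pos _) hab
    exact (by fun_prop : Continuous _).intervalIntegrable _ _
  set M := ∫ t in a..b, v t * exp (-V t) with hM
  set Q := ∫ t in a..b, v t ^ 2 * exp (-V t) with hQ
  set g : ℝ → ℝ := fun t => (v t - M / P) * exp (-V t) with hg
  have hgc : Continuous g := by fun_prop
  set G : ℝ → ℝ := fun t => ∫ s in a..t, g s with hG
  have hGd : ∀ t, HasDerivAt G (g t) t := fun t =>
    intervalIntegral.integral_hasDerivAt_right (hgc.intervalIntegrable _ _)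
      (hgc.stronglyMeasurableAtFilter _ _) hgc.continuousAt
  have hGc : Continuous G := continuous_iff_continuousAt.2 fun t => (hGd t).continuousAt
  have hGa : G a = 0 := by simp [hG]
  have hGb : G b = 0 := by
    simp only [hG, hg, sub_mul]
    rw [intervalIntegral.integral_sub, intervalIntegral.integral_const_mul, ← hM, ← hP]
    · field_simp; ring
    all_goals exact (by fun_prop : Continuous _).intervalIntegrable _ _
  have h1 := weighted_dirichlet hab hV hV' hVc hconv hGd hgc hGa hGb
  have hee : ∀ t, exp (-V t) * exp (V t) = 1 := fun t => by rw [← exp_add]; simp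
  set S := ∫ t in a..b, (v t - M / P) ^ 2 * exp (-V t) with hS
  have e1 : ∫ t in a..b, g t ^ 2 * exp (V t) = S := by
    apply intervalIntegral.integral_congr
    intro t _
    simp only [hg]
    linear_combination ((v t - M / P) ^ 2 * exp (-V t)) * hee t
  rw [e1] at h1
  have hSQ : S = Q - M ^ 2 / P := by
    have : ∀ t, (v t - M / P) ^ 2 * exp (-V t) = v t ^ 2 * exp (-V t) - (2 * (M / P)) * (v t * exp (-V t))
      + (M / P) ^ 2 * exp (-V t) := fun t => by ring
    simp only [hS, this]
    rw [intervalIntegral.integral_add, intervalIntegral.integral_sub, intervalIntegral.integral_const_mul,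
      intervalIntegral.integral_const_mul, ← hM, ← hP, ← hQ]
    · field_simp; ring
    all_goals exact (by fun_prop : Continuous _).intervalIntegrable _ _
  have hd : ∀ t ∈ Set.uIcc a b, HasDerivAt (fun t => (v t - M / P) * G t)
      (v' t * G t + (v t - M / P) ^ 2 * exp (-V t)) t := by
    intro t _
    refine (((hv t).sub_const _).mul (hGd t)).congr_deriv ?_
    simp only [hg]; ring
  have h2 := intervalIntegral.integral_eq_sub_of_hasDerivAt hd
    ((by fun_prop : Continuous _).intervalIntegrable _ _)
  rw [hGa, hGb, intervalIntegral.integral_add, ← hS] at h2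
  rotate_left
  · exact (by fun_prop : Continuous _).intervalIntegrable _ _
  · exact (by fun_prop : Continuous _).intervalIntegrable _ _
  set l := π / (b - a) with hl
  have hlpos : 0 < l := div_pos pi_pos (sub_pos.2 hab)
  set R := ∫ t in a..b, v' t ^ 2 * exp (-V t) with hR
  have h3 : 0 ≤ R + (2 * l ^ 2) * (∫ t in a..b, v' t * G t) + l ^ 4 * ∫ t in a..b, G t ^ 2 * exp (V t) := by
    rw [← intervalIntegral.integral_const_mul, ← intervalIntegral.integral_const_mul,
      ← intervalIntegral.integral_add, ← intervalIntegral.integral_add]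
    · apply intervalIntegral.integral_nonneg hab.le
      intro t _
      have : v' t ^ 2 * exp (-V t) + 2 * l ^ 2 * (v' t * G t) + l ^ 4 * (G t ^ 2 * exp (V t))
        = (v' t + l ^ 2 * G t * exp (V t)) ^ 2 * exp (-V t) := by
        linear_combination (-(2 * l ^ 2 * v' t * G t) - l ^ 4 * G t ^ 2 * exp (V t)) * hee t
      rw [this]; positivity
    all_goals exact (by fun_prop : Continuous _).intervalIntegrable _ _
  have h4 : l ^ 2 * S ≤ R := by nlinarith [mul_le_mul_of_nonneg_left h1 (sq_nonneg l)]
  have h5 : Q * P - M ^ 2 = S * P := by rw [hSQ]; field_simp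
  rw [h5]
  nlinarith

lemma steklov (U : ℝ → ℝ) (hU : Continuous U) :
    ∃ S S' S'' : ℝ → ℝ → ℝ, ∀ h, 0 < h → (∀ t, HasDerivAt (S h) (S' h t) t) ∧
      (∀ t, HasDerivAt (S' h) (S'' h t) t) ∧ Continuous (S'' h) ∧
      (∀ t, S'' h t = (U (t + 2 * h) - 2 * U (t + h) + U t) / h ^ 2) ∧
      (∀ t, ∃ x ∈ Set.Ioo t (t + 2 * h), S h t = U x) := by
  set W : ℝ → ℝ := fun t => ∫ s in (0:ℝ)..t, U s with hW
  have hWd : ∀ t, HasDerivAt W (U t) t := fun t =>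
    intervalIntegral.integral_hasDerivAt_right (hU.intervalIntegrable _ _)
      (hU.stronglyMeasurableAtFilter _ _) hU.continuousAt
  have hWc : Continuous W := continuous_iff_continuousAt.2 fun t => (hWd t).continuousAt
  set Z : ℝ → ℝ := fun t => ∫ s in (0:ℝ)..t, W s with hZ
  have hZd : ∀ t, HasDerivAt Z (W t) t := fun t =>
    intervalIntegral.integral_hasDerivAt_right (hWc.intervalIntegrable _ _)
      (hWc.stronglyMeasurableAtFilter _ _) hWc.continuousAt
  have key : ∀ (F f : ℝ → ℝ), (∀ t, HasDerivAt F (f t) t) → ∀ h, ∀ t,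
      HasDerivAt (fun t => (F (t + 2 * h) - 2 * F (t + h) + F t) / h ^ 2)
        ((f (t + 2 * h) - 2 * f (t + h) + f t) / h ^ 2) t := by
    intro F f hF h t
    exact ((((hF _).comp_add_const t (2 * h)).sub (((hF _).comp_add_const t h).const_mul 2)).add (hF t)).div_const _
  refine ⟨fun h t => (Z (t + 2 * h) - 2 * Z (t + h) + Z t) / h ^ 2,
    fun h t => (W (t + 2 * h) - 2 * W (t + h) + W t) / h ^ 2,
    fun h t => (U (t + 2 * h) - 2 * U (t + h) + U t) / h ^ 2, fun h hh =>
    ⟨key Z W hZd h, key W U hWd h, by fun_prop, fun t => rfl, ?_⟩⟩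
  intro t
  have hD : ∀ s, HasDerivAt (fun s => Z (s + h) - Z s) (W (s + h) - W s) s := fun s =>
    ((hZd _).comp_add_const s h).sub (hZd s)
  obtain ⟨y, hy, hy'⟩ := exists_hasDerivAt_eq_slope (fun s => Z (s + h) - Z s) _ (by linarith : t < t + h)
    (fun s _ => (hD s).continuousAt.continuousWithinAt) (fun s _ => hD s)
  obtain ⟨x, hx, hx'⟩ := exists_hasDerivAt_eq_slope W _ (by linarith : y < y + h)
    (fun s _ => (hWd s).continuousAt.continuousWithinAt) (fun s _ => hWd s)
  refine ⟨x, ⟨by linarith [hy.1, hx.1], by linarith [hy.2, hx.2]⟩, ?_⟩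
  rw [hx', hy']
  have e : t + h + h = t + 2 * h := by ring
  simp only [e, add_sub_cancel_left]
  field_simp
  ring

lemma poincare_mid {a b c e : ℝ} (hac : a < c) (hce : c < e) (heb : e < b)
    {V : ℝ → ℝ} (hV : ConvexOn ℝ (Set.Ioo a b) V)
    {v v' : ℝ → ℝ} (hv : ∀ t, HasDerivAt v (v' t) t) (hc : Continuous v') :
    (π / (e - c)) ^ 2 * ((∫ t in c..e, v t ^ 2 * exp (-V t)) * (∫ t in c..e, exp (-V t))
      - (∫ t in c..e, v t * exp (-V t)) ^ 2) ≤
      (∫ t in c..e, v' t ^ 2 * exp (-V t)) * (∫ t in c..e, exp (-V t)) := by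
  have hvc : Continuous v := continuous_iff_continuousAt.2 fun t => (hv t).continuousAt
  have hVc : ContinuousOn V (Set.Ioo a b) := hV.continuousOn isOpen_Ioo
  obtain ⟨e0, he0, he0'⟩ := exists_between heb
  have hce0 : c ≤ e0 := by linarith
  set U : ℝ → ℝ := Set.IccExtend hce0 (Set.domRestrict (Set.Icc c e0) V) with hU
  have hsub : Set.Icc c e0 ⊆ Set.Ioo a b := fun x hx => ⟨by linarith [hx.1], by linarith [hx.2]⟩
  have hUc : Continuous U := by
    apply Continuous.Icc_extend'
    exact (hVc.mono hsub).domRestrict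
  have hUV : ∀ t ∈ Set.Icc c e0, U t = V t := fun t ht => by
    rw [hU, Set.IccExtend_of_mem _ _ ht]; rfl
  obtain ⟨B, hB⟩ : ∃ B, ∀ t, -B ≤ U t := by
    obtain ⟨x, hx, hx'⟩ := isCompact_Icc.exists_isMinOn (Set.nonempty_Icc.2 hce0) (hVc.mono hsub)
    refine ⟨-(V x), fun t => ?_⟩
    rw [neg_neg]
    exact hx' (Set.projIcc c e0 hce0 t).2
  obtain ⟨S, S', S'', hS⟩ := steklov U hUc
  have hSb : ∀ h, 0 < h → ∀ t, exp (-S h t) ≤ exp B := by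
    intro h hh t
    obtain ⟨x, _, hx⟩ := (hS h hh).2.2.2.2 t
    rw [hx, exp_le_exp]; linarith [hB x]
  have hSl : ∀ t, Tendsto (fun h => S h t) (nhdsWithin 0 (Set.Ioi 0)) (nhds (U t)) := by
    intro t
    rw [Metric.tendsto_nhdsWithin_nhds]
    intro ε hε
    obtain ⟨δ, hδ, hδ'⟩ := Metric.continuous_iff.1 hUc t ε hε
    refine ⟨δ / 2, by positivity, fun h hh hh' => ?_⟩
    obtain ⟨x, hx, hx'⟩ := (hS h hh).2.2.2.2 t
    rw [hx']
    apply hδ'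
    rw [Real.dist_eq, sub_zero, abs_of_pos hh] at hh'
    rw [Real.dist_eq, abs_of_pos (by linarith [hx.1])]
    linarith [hx.2]
  have hlim : ∀ f : ℝ → ℝ, Continuous f → Tendsto (fun h => ∫ t in c..e, f t * exp (-S h t))
      (nhdsWithin 0 (Set.Ioi 0)) (nhds (∫ t in c..e, f t * exp (-V t))) := by
    intro f hf
    have e1 : ∫ t in c..e, f t * exp (-V t) = ∫ t in c..e, f t * exp (-U t) := by
      apply intervalIntegral.integral_congr
      intro t ht
      rw [Set.uIcc_of_le hce.le] at ht
      simp only [hUV t ⟨ht.1, ht.2.trans he0.le⟩]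
    rw [e1]
    apply intervalIntegral.tendsto_integral_filter_of_dominated_convergence (fun t => |f t| * exp B)
    · filter_upwards [self_mem_nhdsWithin] with h hh
      have : Continuous (S h) := continuous_iff_continuousAt.2 fun t => ((hS h hh).1 t).continuousAt
      exact (by fun_prop : Continuous _).aestronglyMeasurable
    · filter_upwards [self_mem_nhdsWithin] with h hh
      refine Eventually.of_forall fun t _ => ?_
      rw [norm_mul, Real.norm_eq_abs, Real.norm_eq_abs, abs_exp]
      exact mul_le_mul_of_nonneg_left (hSb h hh t) (abs_nonneg _)
    · exact (by fun_prop : Continuous _).intervalIntegrable _ _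
    · refine Eventually.of_forall fun t _ => ?_
      exact ((continuous_exp.tendsto _).comp (hSl t).neg).const_mul _
  have h1 := hlim (fun t => v t ^ 2) (by fun_prop)
  have h2 := hlim (fun t => 1) (by fun_prop)
  have h3 := hlim (fun t => v t) (by fun_prop)
  have h4 := hlim (fun t => v' t ^ 2) (by fun_prop)
  simp only [one_mul] at h2
  refine le_of_tendsto_of_tendsto (((h1.mul h2).sub (h3.pow 2)).const_mul _) (h4.mul h2) ?_
  filter_upwards [Ioo_mem_nhdsGT (show (0:ℝ) < (e0 - e) / 2 by linarith)] with h hh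
  obtain ⟨a1, a2, a3, a4, a5⟩ := hS h hh.1
  refine poincare_smooth hce a1 a2 a3 ?_ hv hc
  intro t ht
  rw [a4]
  have m1 : t ∈ Set.Icc c e0 := ⟨ht.1, by linarith [ht.2]⟩
  have m2 : t + h ∈ Set.Icc c e0 := ⟨by linarith [ht.1, hh.1], by linarith [ht.2, hh.2, hh.1]⟩
  have m3 : t + 2 * h ∈ Set.Icc c e0 := ⟨by linarith [ht.1, hh.1], by linarith [ht.2, hh.2, hh.1]⟩
  rw [hUV _ m1, hUV _ m2, hUV _ m3]
  have := hV.2 (hsub m1) (hsub m3) (show (0:ℝ) ≤ 1/2 by norm_num) (show (0:ℝ) ≤ 1/2 by norm_num) (by norm_num)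
  have e2 : (1/2 : ℝ) • t + (1/2 : ℝ) • (t + 2 * h) = t + h := by simp only [smul_eq_mul]; ring
  rw [e2] at this
  simp only [smul_eq_mul] at this
  apply div_nonneg _ (sq_nonneg _)
  linarith

/-- Poincaré inequality on an interval for a log-concave weight. -/
lemma poincare_logconcave {a b : ℝ} (hab : a < b) {p : ℝ → ℝ}
    (hp : ∀ t ∈ Set.Ioo a b, 0 < p t) (hconc : ConcaveOn ℝ (Set.Ioo a b) (fun t => log (p t)))
    (hIgl : IntegrableOn p (Set.Ioo a b))
    {v v' : ℝ → ℝ} (hv : ∀ t, HasDerivAt v (v' t) t) (hc : Continuous v') :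
    (π / (b - a)) ^ 2 * ((∫ t in Set.Ioo a b, v t ^ 2 * p t) * (∫ t in Set.Ioo a b, p t)
      - (∫ t in Set.Ioo a b, v t * p t) ^ 2) ≤
      (∫ t in Set.Ioo a b, v' t ^ 2 * p t) * (∫ t in Set.Ioo a b, p t) := by
  have hvc : Continuous v := continuous_iff_continuousAt.2 fun t => (hv t).continuousAt
  have hlim : ∀ f : ℝ → ℝ, Continuous f → Tendsto (fun h => ∫ t in (a + h)..(b - h), f t * p t)
      (nhdsWithin 0 (Set.Ioi 0)) (nhds (∫ t in Set.Ioo a b, f t * p t)) := by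
    intro f hf
    have hi : IntegrableOn (fun t => f t * p t) (Set.uIcc a b) := by
      rw [Set.uIcc_of_le hab.le]
      exact IntegrableOn.continuousOn_mul hf.continuousOn ((integrableOn_Icc_iff_integrableOn_Ioo (by simp) (by simp)).2 hIgl) isCompact_Icc
    have hcont := intervalIntegral.continuousOn_primitive_interval hi
    rw [Set.uIcc_of_le hab.le] at hi hcont
    have hA : Tendsto (fun h : ℝ => a + h) (nhdsWithin 0 (Set.Ioi 0)) (nhdsWithin a (Set.Icc a b)) := by
      apply tendsto_nhdsWithin_iff.2 ⟨?_, ?_⟩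
      · have : Tendsto (fun h : ℝ => a + h) (nhds 0) (nhds (a + 0)) := (by fun_prop : Continuous _).tendsto _
        rw [add_zero] at this
        exact this.mono_left nhdsWithin_le_nhds
      · filter_upwards [Ioo_mem_nhdsGT (sub_pos.2 hab)] with h hh
        exact ⟨by linarith [hh.1], by linarith [hh.2]⟩
    have hB : Tendsto (fun h : ℝ => b - h) (nhdsWithin 0 (Set.Ioi 0)) (nhdsWithin b (Set.Icc a b)) := by
      apply tendsto_nhdsWithin_iff.2 ⟨?_, ?_⟩
      · have : Tendsto (fun h : ℝ => b - h) (nhds 0) (nhds (b - 0)) := (by fun_prop : Continuous _).tendsto _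
        rw [sub_zero] at this
        exact this.mono_left nhdsWithin_le_nhds
      · filter_upwards [Ioo_mem_nhdsGT (sub_pos.2 hab)] with h hh
        exact ⟨by linarith [hh.2], by linarith [hh.1]⟩
    have l1 := (hcont a ⟨le_rfl, hab.le⟩).tendsto.comp hA
    have l2 := (hcont b ⟨hab.le, le_rfl⟩).tendsto.comp hB
    have l3 := l2.sub l1
    rw [intervalIntegral.integral_same, sub_zero, intervalIntegral.integral_of_le hab.le,
      integral_Ioc_eq_integral_Ioo] at l3
    refine l3.congr' ?_
    filter_upwards [Ioo_mem_nhdsGT (show (0:ℝ) < (b - a) by linarith)] with h hh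
    simp only [Function.comp]
    apply intervalIntegral.integral_interval_sub_left
    · apply IntegrableOn.intervalIntegrable
      apply hi.mono_set
      rw [Set.uIcc_of_le (by linarith [hh.2])]
      exact Set.Icc_subset_Icc le_rfl (by linarith [hh.1])
    · apply IntegrableOn.intervalIntegrable
      apply hi.mono_set
      rw [Set.uIcc_of_le (by linarith [hh.1])]
      exact Set.Icc_subset_Icc le_rfl (by linarith [hh.2])
  have h1 := hlim (fun t => v t ^ 2) (by fun_prop)
  have h2 := hlim (fun t => 1) (by fun_prop)
  have h3 := hlim (fun t => v t) (by fun_prop)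
  have h4 := hlim (fun t => v' t ^ 2) (by fun_prop)
  simp only [one_mul] at h2
  have h5 : Tendsto (fun h : ℝ => (π / ((b - h) - (a + h))) ^ 2) (nhdsWithin 0 (Set.Ioi 0))
      (nhds ((π / (b - a)) ^ 2)) := by
    have : ContinuousAt (fun h : ℝ => (π / ((b - h) - (a + h))) ^ 2) 0 := by
      apply ContinuousAt.pow
      apply ContinuousAt.div₀ (by fun_prop) (by fun_prop)
      simp; linarith
    have := this.tendsto
    simp only [sub_zero, add_zero] at this
    exact this.mono_left nhdsWithin_le_nhds
  refine le_of_tendsto_of_tendsto (h5.mul ((h1.mul h2).sub (h3.pow 2))) (h4.mul h2) ?_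
  filter_upwards [Ioo_mem_nhdsGT (show (0:ℝ) < (b - a) / 2 by linarith)] with h hh
  have hconv : ConvexOn ℝ (Set.Ioo a b) (fun t => - log (p t)) := hconc.neg
  have := poincare_mid (c := a + h) (e := b - h) (by linarith [hh.1]) (by linarith [hh.2]) (by linarith [hh.1]) hconv hv hc
  have hle : a + h ≤ b - h := by linarith [hh.2]
  have e1 : ∀ f : ℝ → ℝ, ∫ t in (a + h)..(b - h), f t * exp (- - log (p t)) = ∫ t in (a + h)..(b - h), f t * p t := by
    intro f
    apply intervalIntegral.integral_congr
    intro t ht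
    rw [Set.uIcc_of_le hle] at ht
    simp only [neg_neg]
    rw [exp_log (hp t ⟨by linarith [ht.1, hh.1], by linarith [ht.2, hh.1]⟩)]
  have e2 := e1 (fun t => 1)
  simp only [one_mul] at e2
  rw [e1, e1, e1, e2] at this
  exact this

lemma bm_one_aux {A B C : Set ℝ} (hA : IsCompact A) (hB : IsCompact B) (hAn : A.Nonempty) (hBn : B.Nonempty)
    (h : ∀ a ∈ A, ∀ b ∈ B, a + b ∈ C) : volume A + volume B ≤ volume C := by
  obtain ⟨k, hk, hk'⟩ := hA.exists_isMaxOn hAn continuousOn_id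
  obtain ⟨m, hm, hm'⟩ := hB.exists_isMinOn hBn continuousOn_id
  rw [← measure_inter_add_sdiff C (measurableSet_Iic (a := k + m))]
  apply add_le_add
  · rw [← measure_preimage_add_right volume (-m) A]
    apply measure_mono
    intro x hx
    refine ⟨by simpa using h _ hx m hm, ?_⟩
    have := hk' hx
    simp only [id, Set.mem_ofPred_eq] at this
    simp only [Set.mem_Iic]; linarith
  · rw [← measure_preimage_add_right volume (-k) B]
    have : volume ((fun x => x + -k) ⁻¹' B) ≤ volume (((fun x => x + -k) ⁻¹' B) \ {k + m}) := by
      rw [measure_sdiff_null (by simp)]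
    refine this.trans (measure_mono ?_)
    rintro x ⟨hx, hx2⟩
    refine ⟨by simpa using h k hk _ hx, ?_⟩
    have := hm' hx
    simp only [id, Set.mem_ofPred_eq] at this
    simp only [Set.mem_Iic, not_le]
    rcases lt_or_eq_of_le (show k + m ≤ x by linarith) with h1 | h1
    · exact h1
    · exact absurd h1.symm hx2

lemma bm_one {A B C : Set ℝ} (hA : MeasurableSet A) (hB : MeasurableSet B) (hAn : A.Nonempty) (hBn : B.Nonempty)
    (h : ∀ a ∈ A, ∀ b ∈ B, a + b ∈ C) : volume A + volume B ≤ volume C := by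
  by_cases hA0 : volume A = 0
  · obtain ⟨a, ha⟩ := hAn
    rw [hA0, zero_add, ← measure_preimage_add_right volume (-a) B]
    apply measure_mono
    intro x hx
    simpa using h a ha _ hx
  by_cases hB0 : volume B = 0
  · obtain ⟨b, hb⟩ := hBn
    rw [hB0, add_zero, ← measure_preimage_add_right volume (-b) A]
    apply measure_mono
    intro x hx
    simpa using h _ hx b hb
  by_contra hlt
  obtain ⟨r, hr, s, hs, hrs⟩ := ENNReal.exists_lt_add_of_lt_add (not_le.1 hlt) hA0 hB0
  refine absurd hrs (not_lt.2 ?_)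
  obtain ⟨K, hKA, hK, hrK⟩ := hA.exists_lt_isCompact hr
  obtain ⟨L, hLB, hL, hsL⟩ := hB.exists_lt_isCompact hs
  have hKn : K.Nonempty := by
    rw [Set.nonempty_iff_ne_empty]; rintro rfl; simp at hrK
  have hLn : L.Nonempty := by
    rw [Set.nonempty_iff_ne_empty]; rintro rfl; simp at hsL
  exact (add_le_add hrK.le hsL.le).trans
    (bm_one_aux hK hL hKn hLn fun a ha b hb => h a (hKA ha) b (hLB hb))

lemma bm_conv {A B C : Set ℝ} {l : ℝ} (h0 : 0 < l) (h1 : l < 1)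
    (hA : MeasurableSet A) (hB : MeasurableSet B) (hAn : A.Nonempty) (hBn : B.Nonempty)
    (h : ∀ a ∈ A, ∀ b ∈ B, (1 - l) * a + l * b ∈ C) :
    ENNReal.ofReal (1 - l) * volume A + ENNReal.ofReal l * volume B ≤ volume C := by
  have key : ∀ (c : ℝ) (hc : 0 < c) (S : Set ℝ), ENNReal.ofReal c * volume S =
      volume ((fun x => c⁻¹ * x) ⁻¹' S) := by
    intro c hc S
    rw [Real.volume_preimage_mul_left (inv_ne_zero hc.ne')]
    simp [abs_of_pos hc]
  rw [key _ (by linarith) A, key _ h0 B]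
  apply bm_one
  · exact hA.preimage (by fun_prop)
  · exact hB.preimage (by fun_prop)
  · obtain ⟨a, ha⟩ := hAn
    refine ⟨(1 - l) * a, ?_⟩
    have : (1 - l) ≠ 0 := by linarith
    simpa [this] using ha
  · obtain ⟨b, hb⟩ := hBn
    refine ⟨l * b, ?_⟩
    simpa [h0.ne'] using hb
  · intro a ha b hb
    have := h _ ha _ hb
    have h3 : (1 - l) ≠ 0 := by linarith
    rwa [mul_inv_cancel_left₀ h3, mul_inv_cancel_left₀ h0.ne'] at this

lemma layercake_ennreal {f : ℝ → ℝ≥0∞} (hf : Measurable f) (hf1 : ∀ x, f x ≤ 1) :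
    ∫⁻ x, f x = ∫⁻ t in Set.Ioi (0:ℝ), volume {x | ENNReal.ofReal t < f x} := by
  have hfin : ∀ x, f x ≠ ⊤ := fun x => ((hf1 x).trans_lt ENNReal.one_lt_top).ne
  have e1 : ∫⁻ x, f x = ∫⁻ x, ENNReal.ofReal ((f x).toReal) := by
    simp_rw [ENNReal.ofReal_toReal (hfin _)]
  rw [e1, lintegral_eq_lintegral_meas_lt volume (Eventually.of_forall fun x => ENNReal.toReal_nonneg)
    hf.ennreal_toReal.aemeasurable]
  apply setLIntegral_congr_fun measurableSet_Ioi
  intro t ht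
  dsimp only
  congr 1
  ext x
  simp only [Set.mem_ofPred_eq]
  rw [ENNReal.ofReal_lt_iff_lt_toReal (le_of_lt ht) (hfin x)]

lemma ennreal_amgm {l : ℝ} (h0 : 0 < l) (h1 : l < 1) (x y : ℝ≥0∞) :
    x ^ (1 - l) * y ^ l ≤ ENNReal.ofReal (1 - l) * x + ENNReal.ofReal l * y := by
  by_cases hx : x = ⊤
  · have : ENNReal.ofReal (1 - l) ≠ 0 := by simp; linarith
    simp [hx, ENNReal.mul_top this]
  by_cases hy : y = ⊤
  · have : ENNReal.ofReal l ≠ 0 := by simp; linarith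
    simp [hy, ENNReal.mul_top this]
  lift x to ℝ≥0 using hx
  lift y to ℝ≥0 using hy
  have := NNReal.geom_mean_le_arith_mean2_weighted (Real.toNNReal (1 - l)) (Real.toNNReal l) x y (by
    rw [← Real.toNNReal_add (by linarith) (by linarith)]; simp)
  rw [Real.coe_toNNReal _ (by linarith), Real.coe_toNNReal _ (by linarith)] at this
  rw [ENNReal.ofReal, ENNReal.ofReal, ← ENNReal.coe_rpow_of_nonneg _ (by linarith), ← ENNReal.coe_rpow_of_nonneg _ (by linarith)]
  exact_mod_cast this

lemma pl_norm {f g h : ℝ → ℝ≥0∞} (hf : Measurable f) (hg : Measurable g) (hh : Measurable h)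
    {l : ℝ} (h0 : 0 < l) (h1 : l < 1) (hfs : ⨆ x, f x = 1) (hgs : ⨆ x, g x = 1)
    (H : ∀ x y, f x ^ (1 - l) * g y ^ l ≤ h ((1 - l) * x + l * y)) :
    (∫⁻ x, f x) ^ (1 - l) * (∫⁻ x, g x) ^ l ≤ ∫⁻ x, h x := by
  have hf1 : ∀ x, f x ≤ 1 := fun x => hfs ▸ le_iSup f x
  have hg1 : ∀ x, g x ≤ 1 := fun x => hgs ▸ le_iSup g x
  refine (ennreal_amgm h0 h1 _ _).trans ?_
  have : ∫⁻ x, min (h x) 1 ≤ ∫⁻ x, h x := lintegral_mono fun x => min_le_left _ _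
  refine le_trans ?_ this
  rw [layercake_ennreal hf hf1, layercake_ennreal hg hg1,
    layercake_ennreal (hh.min measurable_const) (fun x => min_le_right _ _)]
  rw [← lintegral_const_mul' _ _ (by simp), ← lintegral_const_mul' _ _ (by simp)]
  refine (le_lintegral_add _ _).trans ?_
  apply setLIntegral_mono' measurableSet_Ioi
  intro t ht
  by_cases ht1 : t < 1
  · have ht1' : ENNReal.ofReal t < 1 := by simpa using ht1
    apply bm_conv h0 h1 (measurableSet_lt measurable_const hf) (measurableSet_lt measurable_const hg)
    · obtain ⟨x, hx⟩ := lt_iSup_iff.1 (hfs.symm ▸ ht1'); exact ⟨x, hx⟩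
    · obtain ⟨x, hx⟩ := lt_iSup_iff.1 (hgs.symm ▸ ht1'); exact ⟨x, hx⟩
    · intro a ha b hb
      simp only [Set.mem_ofPred_eq, lt_min_iff] at ha hb ⊢
      refine ⟨lt_of_lt_of_le ?_ (H a b), ht1'⟩
      have hpos : (0 : ℝ) < 1 - l := by linarith
      have htp : ENNReal.ofReal t ≠ 0 := by simpa using ht
      calc ENNReal.ofReal t = ENNReal.ofReal t ^ (1 - l) * ENNReal.ofReal t ^ l := by
            rw [← ENNReal.rpow_add _ _ htp (by simp)]; simp
        _ < f a ^ (1 - l) * g b ^ l := by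
          apply ENNReal.mul_lt_mul
          · exact ENNReal.rpow_lt_rpow ha hpos
          · exact ENNReal.rpow_lt_rpow hb h0
  · have ht1' : 1 ≤ ENNReal.ofReal t := by simpa using ht1
    have e1 : {x | ENNReal.ofReal t < f x} = ∅ := by
      ext x; simpa using (hf1 x).trans ht1'
    have e2 : {x | ENNReal.ofReal t < g x} = ∅ := by
      ext x; simpa using (hg1 x).trans ht1'
    simp [e1, e2]

lemma pl_bdd {f g h : ℝ → ℝ≥0∞} (hf : Measurable f) (hg : Measurable g) (hh : Measurable h)
    {l : ℝ} (h0 : 0 < l) (h1 : l < 1) (hfs : ⨆ x, f x ≠ ⊤) (hgs : ⨆ x, g x ≠ ⊤)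
    (H : ∀ x y, f x ^ (1 - l) * g y ^ l ≤ h ((1 - l) * x + l * y)) :
    (∫⁻ x, f x) ^ (1 - l) * (∫⁻ x, g x) ^ l ≤ ∫⁻ x, h x := by
  have h1' : (0:ℝ) < 1 - l := by linarith
  set M := ⨆ x, f x with hM
  set N := ⨆ x, g x with hN
  by_cases hM0 : M = 0
  · have : ∀ x, f x = 0 := fun x => le_antisymm (hM0 ▸ le_iSup f x) bot_le
    simp [this, ENNReal.zero_rpow_of_pos h1']
  by_cases hN0 : N = 0
  · have : ∀ x, g x = 0 := fun x => le_antisymm (hN0 ▸ le_iSup g x) bot_le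
    simp [this, ENNReal.zero_rpow_of_pos h0]
  set c := (M⁻¹) ^ (1 - l) * (N⁻¹) ^ l with hc
  have hMi0 : M⁻¹ ≠ 0 := ENNReal.inv_ne_zero.2 hfs
  have hNi0 : N⁻¹ ≠ 0 := ENNReal.inv_ne_zero.2 hgs
  have hMit : M⁻¹ ≠ ⊤ := ENNReal.inv_ne_top.2 hM0
  have hNit : N⁻¹ ≠ ⊤ := ENNReal.inv_ne_top.2 hN0
  have hc0 : c ≠ 0 := mul_ne_zero (by simp [ENNReal.rpow_eq_zero_iff, hMi0, hMit, hM0, hfs]) (by simp [ENNReal.rpow_eq_zero_iff, hNi0, hNit, hN0, hgs])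
  have hct : c ≠ ⊤ := ENNReal.mul_ne_top (ENNReal.rpow_ne_top_of_nonneg h1'.le hMit) (ENNReal.rpow_ne_top_of_nonneg h0.le hNit)
  have key := pl_norm (f := fun x => M⁻¹ * f x) (g := fun x => N⁻¹ * g x) (h := fun x => c * h x)
    (hf.const_mul _) (hg.const_mul _) (hh.const_mul _) h0 h1
    (by rw [← ENNReal.mul_iSup, ← hM, ENNReal.inv_mul_cancel hM0 hfs])
    (by rw [← ENNReal.mul_iSup, ← hN, ENNReal.inv_mul_cancel hN0 hgs])
    (by
      intro x y
      rw [ENNReal.mul_rpow_of_nonneg _ _ h1'.le, ENNReal.mul_rpow_of_nonneg _ _ h0.le, mul_mul_mul_comm]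
      exact mul_le_mul_right (H x y) c)
  rw [lintegral_const_mul _ hf, lintegral_const_mul _ hg, lintegral_const_mul _ hh,
    ENNReal.mul_rpow_of_nonneg _ _ h1'.le, ENNReal.mul_rpow_of_nonneg _ _ h0.le, mul_mul_mul_comm] at key
  exact (ENNReal.mul_le_mul_iff_right hc0 hct).1 key

lemma pl_one {f g h : ℝ → ℝ≥0∞} (hf : Measurable f) (hg : Measurable g) (hh : Measurable h)
    {l : ℝ} (h0 : 0 < l) (h1 : l < 1)
    (H : ∀ x y, f x ^ (1 - l) * g y ^ l ≤ h ((1 - l) * x + l * y)) :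
    (∫⁻ x, f x) ^ (1 - l) * (∫⁻ x, g x) ^ l ≤ ∫⁻ x, h x := by
  have h1' : (0:ℝ) < 1 - l := by linarith
  have hlim : ∀ f : ℝ → ℝ≥0∞, Measurable f → Monotone (fun n : ℕ => ∫⁻ x, min (f x) n) ∧
      ⨆ n : ℕ, ∫⁻ x, min (f x) n = ∫⁻ x, f x := by
    intro f hf
    have hm : Monotone (fun (n : ℕ) x => min (f x) (n : ℝ≥0∞)) := by
      intro m n hmn x
      exact min_le_min le_rfl (by exact_mod_cast hmn)
    refine ⟨fun m n hmn => lintegral_mono (hm hmn), ?_⟩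
    rw [← lintegral_iSup (fun n => hf.min measurable_const) hm]
    congr 1
    ext x
    have : ⨆ n : ℕ, min (f x) (n : ℝ≥0∞) = min (f x) (⨆ n : ℕ, (n : ℝ≥0∞)) := by
      rw [inf_iSup_eq]
    rw [this, ENNReal.iSup_natCast]; simp
  have tf := tendsto_atTop_iSup (hlim f hf).1
  have tg := tendsto_atTop_iSup (hlim g hg).1
  rw [(hlim f hf).2] at tf
  rw [(hlim g hg).2] at tg
  by_cases hfz : ∫⁻ x, f x = 0
  · simp [hfz, ENNReal.zero_rpow_of_pos h1']
  by_cases hgz : ∫⁻ x, g x = 0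
  · simp [hgz, ENNReal.zero_rpow_of_pos h0]
  have t1 := (ENNReal.continuous_rpow_const (y := 1 - l)).tendsto _ |>.comp tf
  have t2 := (ENNReal.continuous_rpow_const (y := l)).tendsto _ |>.comp tg
  refine le_of_tendsto (ENNReal.Tendsto.mul t1 (Or.inl ?_) t2 (Or.inl ?_)) (Eventually.of_forall fun n => ?_)
  · simp [ENNReal.rpow_eq_zero_iff, hfz]; intro _; linarith
  · simp [ENNReal.rpow_eq_zero_iff, hgz]; intro _; linarith
  · apply pl_bdd (hf.min measurable_const) (hg.min measurable_const) hh h0 h1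
    · exact ((iSup_le fun x => min_le_right _ _).trans_lt (ENNReal.natCast_lt_top n)).ne
    · exact ((iSup_le fun x => min_le_right _ _).trans_lt (ENNReal.natCast_lt_top n)).ne
    · intro x y
      refine le_trans ?_ (H x y)
      gcongr
      · exact min_le_left _ _
      · exact min_le_left _ _

lemma lintegral_fin_succ {n : ℕ} {f : (Fin (n + 1) → ℝ) → ℝ≥0∞} (hf : Measurable f) :
    ∫⁻ x, f x = ∫⁻ t : ℝ, ∫⁻ y : Fin n → ℝ, f (Fin.cons t y) := by
  have := (volume_preserving_piFinSuccAbove (fun _ : Fin (n + 1) => ℝ) 0).symm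
  rw [← this.lintegral_comp hf]
  rw [Measure.volume_eq_prod, lintegral_prod]
  · simp only [MeasurableEquiv.piFinSuccAbove_symm_apply, Fin.insertNthEquiv, Equiv.coe_fn_mk, Fin.insertNth_zero]
    rfl
  · exact (hf.comp (MeasurableEquiv.measurable _)).aemeasurable

lemma measurable_fin_cons {n : ℕ} :
    Measurable (fun z : ℝ × (Fin n → ℝ) => (Fin.cons z.1 z.2 : Fin (n + 1) → ℝ)) := by
  refine measurable_pi_iff.2 fun i => ?_
  refine Fin.cases ?_ (fun i => ?_) i
  · simpa using measurable_fst
  · simp only [Fin.cons_succ]; fun_prop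

theorem prekopa_leindler (n : ℕ) : ∀ {f g h : (Fin n → ℝ) → ℝ≥0∞} (_ : Measurable f) (_ : Measurable g)
    (_ : Measurable h) {l : ℝ} (_ : 0 < l) (_ : l < 1)
    (_ : ∀ x y, f x ^ (1 - l) * g y ^ l ≤ h ((1 - l) • x + l • y)),
    (∫⁻ x, f x) ^ (1 - l) * (∫⁻ x, g x) ^ l ≤ ∫⁻ x, h x := by
  induction n with
  | zero =>
    intro f g h hf hg hh l h0 h1 H
    have : (volume : Measure (Fin 0 → ℝ)) Set.univ = 1 := by
      rw [volume_pi, Measure.pi_univ]; simp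
    rw [lintegral_unique, lintegral_unique, lintegral_unique, this, mul_one, mul_one, mul_one]
    convert H default default
  | succ n ih =>
    intro f g h hf hg hh l h0 h1 H
    rw [lintegral_fin_succ hf, lintegral_fin_succ hg, lintegral_fin_succ hh]
    have hm : ∀ f : (Fin (n + 1) → ℝ) → ℝ≥0∞, Measurable f →
        Measurable (fun t : ℝ => ∫⁻ y : Fin n → ℝ, f (Fin.cons t y)) := by
      intro f hf
      exact Measurable.lintegral_prod_right' (f := fun z : ℝ × (Fin n → ℝ) => f (Fin.cons z.1 z.2)) (hf.comp measurable_fin_cons)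
    apply pl_one (hm f hf) (hm g hg) (hm h hh) h0 h1
    intro s t
    have hs : ∀ s : ℝ, ∀ f : (Fin (n + 1) → ℝ) → ℝ≥0∞, Measurable f → Measurable (fun y : Fin n → ℝ => f (Fin.cons s y)) :=
      fun s f hf => (hf.comp measurable_fin_cons).comp measurable_prodMk_left
    apply ih (hs s f hf) (hs t g hg) (hs _ h hh) h0 h1
    intro x y
    refine (H _ _).trans (le_of_eq ?_)
    congr 1
    ext i
    refine Fin.cases ?_ (fun i => ?_) i <;> simp

/-- Slices of convex sets have log-concave volume. -/
lemma slice_logconcave {n : ℕ} {C : Set (Fin (n + 1) → ℝ)} (hC : Convex ℝ C) (hm : MeasurableSet C)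
    {l : ℝ} (h0 : 0 < l) (h1 : l < 1) (s t : ℝ) :
    (volume {y : Fin n → ℝ | Fin.cons s y ∈ C}) ^ (1 - l) * (volume {y : Fin n → ℝ | Fin.cons t y ∈ C}) ^ l
      ≤ volume {y : Fin n → ℝ | Fin.cons ((1 - l) * s + l * t) y ∈ C} := by
  have hs : ∀ s : ℝ, MeasurableSet {y : Fin n → ℝ | (Fin.cons s y : Fin (n + 1) → ℝ) ∈ C} := fun s =>
    (measurable_fin_cons.comp measurable_prodMk_left) hm
  have h1' : (0:ℝ) < 1 - l := by linarith
  rw [← lintegral_indicator_one (hs s), ← lintegral_indicator_one (hs t), ← lintegral_indicator_one (hs _)]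
  apply prekopa_leindler n (measurable_one.indicator (hs s)) (measurable_one.indicator (hs t))
    (measurable_one.indicator (hs _)) h0 h1
  intro x y
  by_cases hx : (Fin.cons s x : Fin (n + 1) → ℝ) ∈ C
  · by_cases hy : (Fin.cons t y : Fin (n + 1) → ℝ) ∈ C
    · have := hC hx hy h1'.le h0.le (by ring)
      rw [Set.indicator_of_mem (a := x) (by exact hx), Set.indicator_of_mem (a := y) (by exact hy), Set.indicator_of_mem]
      · simp
      · simp only [Set.mem_ofPred_eq]
        convert this using 1
        ext i
        refine Fin.cases ?_ (fun i => ?_) i <;> simp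
    · rw [Set.indicator_of_notMem (a := y) (by exact hy), ENNReal.zero_rpow_of_pos h0]; simp
  · rw [Set.indicator_of_notMem (a := x) (by exact hx), ENNReal.zero_rpow_of_pos h1']; simp

lemma marginal {n : ℕ} {C : Set (Fin (n + 1) → ℝ)} (hm : MeasurableSet C) (hb : Bornology.IsBounded C)
    {φ : ℝ → ℝ} (hφ : Continuous φ) :
    Integrable (fun t => φ t * volume.real {y : Fin n → ℝ | Fin.cons t y ∈ C}) ∧
    ∫ z in C, φ (z 0) = ∫ t, φ t * volume.real {y : Fin n → ℝ | Fin.cons t y ∈ C} := by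
  have hs : ∀ s : ℝ, MeasurableSet {y : Fin n → ℝ | (Fin.cons s y : Fin (n + 1) → ℝ) ∈ C} := fun s =>
    (measurable_fin_cons.comp measurable_prodMk_left) hm
  have hi : Integrable (C.indicator (fun z => φ (z 0))) := by
    rw [integrable_indicator_iff hm]
    have hc : IsCompact (closure C) := hb.isCompact_closure
    have : Continuous (fun z : Fin (n + 1) → ℝ => φ (z 0)) := by fun_prop
    exact (this.continuousOn.integrableOn_compact hc).mono_set subset_closure
  set e := (MeasurableEquiv.piFinSuccAbove (fun _ : Fin (n + 1) => ℝ) 0).symm with he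
  have mp : MeasurePreserving e volume volume :=
    (volume_preserving_piFinSuccAbove (fun _ : Fin (n + 1) => ℝ) 0).symm
  have hi2 : Integrable (fun z => C.indicator (fun z => φ (z 0)) (e z)) :=
    (mp.integrable_comp_emb e.measurableEmbedding).2 hi
  have hev : ∀ t y, e (t, y) = Fin.cons t y := by
    intro t y
    simp only [he, MeasurableEquiv.piFinSuccAbove_symm_apply, Fin.insertNthEquiv, Equiv.coe_fn_mk, Fin.insertNth_zero]
    rfl
  have hin : ∀ t, ∫ y, C.indicator (fun z => φ (z 0)) (e (t, y)) =
      φ t * volume.real {y : Fin n → ℝ | Fin.cons t y ∈ C} := by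
    intro t
    have : ∀ y, C.indicator (fun z => φ (z 0)) (e (t, y)) =
        Set.indicator {y : Fin n → ℝ | (Fin.cons t y : Fin (n + 1) → ℝ) ∈ C} (fun _ => φ t) y := by
      intro y
      rw [hev]
      by_cases h : (Fin.cons t y : Fin (n + 1) → ℝ) ∈ C
      · rw [Set.indicator_of_mem h, Set.indicator_of_mem (by exact h)]; simp
      · rw [Set.indicator_of_notMem h, Set.indicator_of_notMem (by exact h)]
    simp_rw [this]
    rw [integral_indicator_const _ (hs t), smul_eq_mul, mul_comm]
  rw [Measure.volume_eq_prod] at hi2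
  constructor
  · have := hi2.integral_prod_left
    simpa only [hin] using this
  · rw [← integral_indicator hm, ← mp.integral_comp', Measure.volume_eq_prod, integral_prod _ hi2]
    simp only [hin]

lemma open_interval {I : Set ℝ} (hn : I.Nonempty) (ho : IsOpen I) (hc : Convex ℝ I)
    {D : ℝ} (hD : ∀ x ∈ I, ∀ y ∈ I, y - x ≤ D) : ∃ a b, a < b ∧ b - a ≤ D ∧ I = Set.Ioo a b := by
  obtain ⟨x0, hx0⟩ := hn
  have hba : BddAbove I := ⟨x0 + D, fun y hy => by linarith [hD x0 hx0 y hy]⟩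
  have hbb : BddBelow I := ⟨x0 - D, fun y hy => by linarith [hD y hy x0 hx0]⟩
  have hI : I = Set.Ioo (sInf I) (sSup I) := by
    ext t
    constructor
    · intro ht
      obtain ⟨ε, hε, hball⟩ := Metric.isOpen_iff.1 ho t ht
      have h1 : t - ε / 2 ∈ I := hball (by rw [Metric.mem_ball, Real.dist_eq]; rw [abs_lt]; constructor <;> linarith)
      have h2 : t + ε / 2 ∈ I := hball (by rw [Metric.mem_ball, Real.dist_eq]; rw [abs_lt]; constructor <;> linarith)
      exact ⟨by linarith [csInf_le hbb h1], by linarith [le_csSup hba h2]⟩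
    · rintro ⟨h1, h2⟩
      obtain ⟨x, hx, hx'⟩ := exists_lt_of_csInf_lt ⟨x0, hx0⟩ h1
      obtain ⟨y, hy, hy'⟩ := exists_lt_of_lt_csSup ⟨x0, hx0⟩ h2
      exact hc.ordConnected.out hx hy ⟨hx'.le, hy'.le⟩
  refine ⟨sInf I, sSup I, ?_, ?_, hI⟩
  · rw [hI] at hx0; exact hx0.1.trans hx0.2
  · have : sSup I ≤ sInf I + D := by
      apply csSup_le ⟨x0, hx0⟩
      intro y hy
      have : y - D ≤ sInf I := le_csInf ⟨x0, hx0⟩ fun x hx => by linarith [hD x hx y hy]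
      linarith
    linarith

lemma needle_coord {n : ℕ} {C : Set (Fin (n + 1) → ℝ)} (hn : C.Nonempty) (ho : IsOpen C) (hc : Convex ℝ C)
    (hb : Bornology.IsBounded C) {D : ℝ} (hD : ∀ x ∈ C, ∀ y ∈ C, y 0 - x 0 ≤ D)
    {v v' : ℝ → ℝ} (hv : ∀ t, HasDerivAt v (v' t) t) (hc' : Continuous v') :
    (π / D) ^ 2 * ((∫ z in C, v (z 0) ^ 2) * volume.real C - (∫ z in C, v (z 0)) ^ 2) ≤
      (∫ z in C, v' (z 0) ^ 2) * volume.real C := by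
  have hvc : Continuous v := continuous_iff_continuousAt.2 fun t => (hv t).continuousAt
  set p : ℝ → ℝ := fun t => volume.real {y : Fin n → ℝ | (Fin.cons t y : Fin (n + 1) → ℝ) ∈ C} with hp
  set I : Set ℝ := (fun z : Fin (n + 1) → ℝ => z 0) '' C with hI
  have hIo : IsOpen I := (isOpenMap_eval 0) C ho
  have hIc : Convex ℝ I := by
    have := hc.linear_image (LinearMap.proj 0 : (Fin (n + 1) → ℝ) →ₗ[ℝ] ℝ)
    exact this
  obtain ⟨a, b, hab, hbaD, hIab⟩ := open_interval (hn.image _) hIo hIc (D := D) (by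
    rintro _ ⟨x, hx, rfl⟩ _ ⟨y, hy, rfl⟩; exact hD x hx y hy)
  have hcont : ∀ t : ℝ, Continuous (fun y : Fin n → ℝ => (Fin.cons t y : Fin (n + 1) → ℝ)) := by
    intro t
    refine continuous_pi fun i => ?_
    refine Fin.cases ?_ (fun i => ?_) i
    · simpa using continuous_const
    · simp only [Fin.cons_succ]; fun_prop
  have hfin : ∀ t : ℝ, volume {y : Fin n → ℝ | (Fin.cons t y : Fin (n + 1) → ℝ) ∈ C} ≠ ⊤ := by
    intro t
    apply ne_of_lt
    apply Bornology.IsBounded.measure_lt_top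
    obtain ⟨R, hR⟩ := hb.subset_closedBall 0
    apply (Metric.isBounded_closedBall (x := (0 : Fin n → ℝ)) (r := R)).subset
    intro y hy
    have h1 := hR hy
    rw [mem_closedBall_zero_iff] at h1 ⊢
    have hR0 : 0 ≤ R := (norm_nonneg _).trans h1
    rw [pi_norm_le_iff_of_nonneg hR0] at h1 ⊢
    intro i
    simpa using h1 i.succ
  have hpos : ∀ t ∈ Set.Ioo a b, 0 < p t := by
    intro t ht
    rw [← hIab] at ht
    obtain ⟨z, hz, rfl⟩ := ht
    apply ENNReal.toReal_pos _ (hfin _)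
    apply (IsOpen.measure_pos _ (ho.preimage (hcont _)) _).ne'
    exact ⟨fun i => z i.succ, by simp only [Set.mem_preimage]; convert hz; ext i; refine Fin.cases ?_ (fun i => ?_) i <;> simp⟩
  have hzero : ∀ t, t ∉ Set.Ioo a b → p t = 0 := by
    intro t ht
    rw [← hIab] at ht
    have : {y : Fin n → ℝ | (Fin.cons t y : Fin (n + 1) → ℝ) ∈ C} = ∅ := by
      ext y
      simp only [Set.mem_ofPred_eq, Set.mem_empty_iff_false, iff_false]
      intro h
      exact ht ⟨_, h, by simp⟩
    simp [hp, this]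
  have hconc : ConcaveOn ℝ (Set.Ioo a b) (fun t => log (p t)) := by
    rw [concaveOn_iff_forall_pos]
    refine ⟨convex_Ioo a b, ?_⟩
    intro x hx y hy α β hα hβ hαβ
    have hα' : α = 1 - β := by linarith
    have h := slice_logconcave hc ho.measurableSet hβ (by linarith) x y
    have h2 := ENNReal.toReal_mono (hfin _) h
    rw [ENNReal.toReal_mul, ← ENNReal.toReal_rpow, ← ENNReal.toReal_rpow] at h2
    change p x ^ (1 - β) * p y ^ β ≤ p ((1 - β) * x + β * y) at h2
    have hpx := hpos x hx
    have hpy := hpos y hy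
    have := log_le_log (by positivity) h2
    rw [log_mul (by positivity) (by positivity), log_rpow hpx, log_rpow hpy] at this
    simpa only [smul_eq_mul, hα'] using this
  have hmar : ∀ φ : ℝ → ℝ, Continuous φ → ∫ z in C, φ (z 0) = ∫ t in Set.Ioo a b, φ t * p t := by
    intro φ hφ
    rw [(marginal ho.measurableSet hb hφ).2]
    symm
    apply setIntegral_eq_integral_of_forall_compl_eq_zero
    intro t ht
    change φ t * p t = 0
    rw [hzero t ht, mul_zero]
  have hIgl : IntegrableOn p (Set.Ioo a b) := by
    have := (marginal ho.measurableSet hb (φ := fun _ => 1) continuous_const).1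
    simp only [one_mul] at this
    exact this.integrableOn
  have hvol : volume.real C = ∫ t in Set.Ioo a b, p t := by
    have := hmar (fun _ => 1) continuous_const
    simpa using this
  have key := poincare_logconcave hab hpos hconc hIgl hv hc'
  rw [hvol, hmar (fun t => v t ^ 2) (by fun_prop), hmar v hvc, hmar (fun t => v' t ^ 2) (by fun_prop)]
  set X := (∫ t in Set.Ioo a b, v t ^ 2 * p t) * (∫ t in Set.Ioo a b, p t) - (∫ t in Set.Ioo a b, v t * p t) ^ 2
  have hba : 0 < b - a := by linarith
  by_cases hX : 0 ≤ X
  · refine le_trans ?_ key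
    apply mul_le_mul_of_nonneg_right _ hX
    have := pi_pos
    have hDpos : 0 < D := hba.trans_le (by assumption)
    have h0 : 0 ≤ π / D := by positivity
    gcongr
  · have h1 : (π / D) ^ 2 * X ≤ 0 := mul_nonpos_of_nonneg_of_nonpos (sq_nonneg _) (by linarith)
    refine h1.trans (mul_nonneg ?_ ?_)
    · apply setIntegral_nonneg measurableSet_Ioo
      intro t ht
      have := hpos t ht
      positivity
    · apply setIntegral_nonneg measurableSet_Ioo
      intro t ht
      exact (hpos t ht).le

lemma needle_euc {n : ℕ} {C : Set (Euc (n + 1))} (hn : C.Nonempty) (ho : IsOpen C) (hc : Convex ℝ C)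
    (hb : Bornology.IsBounded C) {D : ℝ} (hD : ∀ x ∈ C, ∀ y ∈ C, dist x y ≤ D) {e : Euc (n + 1)} (he : ‖e‖ = 1)
    {v v' : ℝ → ℝ} (hv : ∀ t, HasDerivAt v (v' t) t) (hc' : Continuous v') :
    (π / D) ^ 2 * ((∫ z in C, v (inner ℝ e z) ^ 2) * volume.real C - (∫ z in C, v (inner ℝ e z)) ^ 2) ≤
      (∫ z in C, v' (inner ℝ e z) ^ 2) * volume.real C := by
  obtain ⟨b, hbe⟩ : ∃ b : OrthonormalBasis (Fin (n + 1)) ℝ (Euc (n + 1)), b 0 = e := by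
    obtain ⟨b, hb⟩ := Orthonormal.exists_orthonormalBasis_extension_of_card_eq (𝕜 := ℝ) (E := Euc (n + 1)) (ι := Fin (n + 1))
      (by simp) (v := fun _ => e) (s := {0}) (by
        constructor
        · intro i; simpa using he
        · intro i j hij; exact absurd (Subsingleton.elim i j) hij)
    exact ⟨b, hb 0 rfl⟩
  set L : Euc (n + 1) ≃L[ℝ] (Fin (n + 1) → ℝ) :=
    b.repr.toContinuousLinearEquiv.trans (PiLp.continuousLinearEquiv 2 ℝ (fun _ : Fin (n + 1) => ℝ)) with hL
  have hL0 : ∀ z, L z 0 = inner ℝ e z := by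
    intro z
    rw [← hbe, ← b.repr_apply_apply]; rfl
  have mp : MeasurePreserving L volume volume := by
    exact (PiLp.volume_preserving_ofLp (Fin (n + 1))).comp b.measurePreserving_repr
  have hemb : MeasurableEmbedding L := L.toHomeomorph.measurableEmbedding
  set C' : Set (Fin (n + 1) → ℝ) := L.symm ⁻¹' C with hC'
  have hCC' : C = L ⁻¹' C' := by ext; simp [hC']
  have hIgl : ∀ φ : ℝ → ℝ, ∫ z in C, φ (inner ℝ e z) = ∫ z in C', φ (z 0) := by
    intro φ
    rw [← mp.setIntegral_preimage_emb hemb, ← hCC']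
    simp only [hL0]
  have hvol : volume.real C = volume.real C' := by
    have := hIgl (fun _ => 1)
    simpa using this
  have hmemL : ∀ z ∈ C', ∃ x ∈ C, L x = z := fun z hz => ⟨L.symm z, hz, by simp⟩
  have key := needle_coord (C := C') (D := D) ?_ (ho.preimage L.symm.continuous) ?_ ?_ ?_ hv hc'
  · rw [hvol, hIgl v, hIgl (fun t => v t ^ 2), hIgl (fun t => v' t ^ 2)]
    exact key
  · obtain ⟨x, hx⟩ := hn
    exact ⟨L x, by simpa [hC'] using hx⟩
  · exact hc.linear_preimage L.symm.toLinearMap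
  · have : C' = L '' C := by
      rw [hC']; exact (L.toEquiv.image_eq_preimage_symm C).symm
    rw [this]
    exact L.lipschitz.isBounded_image hb
  · intro x hx y hy
    obtain ⟨x', hx', rfl⟩ := hmemL x hx
    obtain ⟨y', hy', rfl⟩ := hmemL y hy
    rw [hL0, hL0, ← inner_sub_right]
    refine (real_inner_le_norm _ _).trans ?_
    rw [he, one_mul, ← dist_eq_norm]
    exact hD _ (by assumption) _ (by assumption)

lemma hyperplane_null {d : ℕ} {m : Euc d} (hm : m ≠ 0) (x : Euc d) :
    volume {z : Euc d | inner ℝ m (z - x) = 0} = 0 := by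
  have h1 : (volume : Measure (Euc d)) (((innerSL ℝ m : Euc d →L[ℝ] ℝ).toLinearMap.ker : Submodule ℝ (Euc d)) : Set (Euc d)) = 0 := by
    apply Measure.addHaar_submodule
    intro h
    have : m ∈ (innerSL ℝ m : Euc d →L[ℝ] ℝ).toLinearMap.ker := by rw [h]; trivial
    simp at this
    exact hm this
  have h2 := measure_preimage_add_right (volume : Measure (Euc d)) (-x) (((innerSL ℝ m : Euc d →L[ℝ] ℝ).toLinearMap.ker : Submodule ℝ (Euc d)) : Set (Euc d))
  rw [h1] at h2
  convert h2 using 2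
  ext z
  simp [sub_eq_add_neg]

lemma half_split {d : ℕ} {C : Set (Euc d)} (ho : IsOpen C) (hb : Bornology.IsBounded C) {g : Euc d → ℝ}
    (hg : Continuous g) {m : Euc d} (hm : m ≠ 0) (x : Euc d) :
    ∫ z in C, g z = (∫ z in C ∩ {z | 0 < inner ℝ m (z - x)}, g z) + ∫ z in C ∩ {z | 0 < inner ℝ (-m) (z - x)}, g z := by
  have hIgl : IntegrableOn g C := (hg.continuousOn.integrableOn_compact hb.isCompact_closure).mono_set subset_closure
  have hmeas : MeasurableSet {z : Euc d | 0 < inner ℝ m (z - x)} :=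
    (isOpen_lt continuous_const (by fun_prop)).measurableSet
  rw [← integral_inter_add_sdiff hmeas hIgl]
  congr 1
  apply setIntegral_congr_set
  have hnull := hyperplane_null hm x
  have : ∀ᵐ z : Euc d, ¬ inner ℝ m (z - x) = 0 := by
    rw [ae_iff]; simpa using hnull
  filter_upwards [this] with z hz
  apply propext
  change (z ∈ C ∧ ¬ (0 < inner ℝ m (z - x))) ↔ (z ∈ C ∧ 0 < inner ℝ (-m) (z - x))
  rw [inner_neg_left]
  constructor
  · rintro ⟨h1, h2⟩
    refine ⟨h1, ?_⟩
    have := lt_of_le_of_ne (not_lt.mp h2) hz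
    linarith
  · rintro ⟨h1, h2⟩
    exact ⟨h1, by linarith⟩

lemma bisect {d : ℕ} {C : Set (Euc d)} (ho : IsOpen C) (hb : Bornology.IsBounded C) {u : Euc d → ℝ}
    (hu : Continuous u) (h0 : ∫ z in C, u z = 0) (x : Euc d) {n : ℝ → Euc d} (hn : Continuous n)
    (hne : ∀ θ, n θ ≠ 0) (hpi : n π = - n 0) :
    ∃ θ, ∫ z in C ∩ {z | 0 < inner ℝ (n θ) (z - x)}, u z = 0 := by
  set h : ℝ → ℝ := fun θ => ∫ z in C ∩ {z | 0 < inner ℝ (n θ) (z - x)}, u z with hh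
  have hIgl : IntegrableOn u C := (hu.continuousOn.integrableOn_compact hb.isCompact_closure).mono_set subset_closure
  have hmeas : ∀ θ, MeasurableSet {z : Euc d | 0 < inner ℝ (n θ) (z - x)} := fun θ =>
    (isOpen_lt continuous_const (by fun_prop)).measurableSet
  have hh2 : ∀ θ, h θ = ∫ z in C, ({z | 0 < inner ℝ (n θ) (z - x)} : Set (Euc d)).indicator u z := by
    intro θ
    rw [setIntegral_indicator (hmeas θ)]
  have hcont : Continuous h := by
    rw [continuous_iff_continuousAt]
    intro θ
    have : h = fun θ => ∫ z in C, ({z | 0 < inner ℝ (n θ) (z - x)} : Set (Euc d)).indicator u z := funext hh2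
    rw [this]
    apply continuousAt_of_dominated (bound := fun z => ‖u z‖)
    · exact Eventually.of_forall fun θ => hu.aestronglyMeasurable.indicator (hmeas θ)
    · exact Eventually.of_forall fun θ => Eventually.of_forall fun z => norm_indicator_le_norm_self _ _
    · exact hIgl.norm
    · apply ae_restrict_of_ae
      have hnull := hyperplane_null (hne θ) x
      have : ∀ᵐ z : Euc d, ¬ inner ℝ (n θ) (z - x) = 0 := by
        rw [ae_iff]; simpa using hnull
      filter_upwards [this] with z hz
      have hc : Continuous fun θ => (inner ℝ (n θ) (z - x) : ℝ) := by fun_prop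
      rcases lt_or_gt_of_ne hz with h1 | h1
      · have : (fun θ => ({z | 0 < inner ℝ (n θ) (z - x)} : Set (Euc d)).indicator u z) =ᶠ[nhds θ] fun _ => 0 := by
          filter_upwards [hc.continuousAt.eventually_lt_const h1] with t ht
          apply Set.indicator_of_notMem
          simp only [Set.mem_ofPred_eq]; linarith
        exact continuousAt_const.congr this.symm
      · have : (fun θ => ({z | 0 < inner ℝ (n θ) (z - x)} : Set (Euc d)).indicator u z) =ᶠ[nhds θ] fun _ => u z := by
          filter_upwards [hc.continuousAt.eventually_const_lt h1] with t ht
          apply Set.indicator_of_mem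
          simpa only [Set.mem_ofPred_eq] using ht
        exact continuousAt_const.congr this.symm
  have hanti : h 0 + h π = 0 := by
    rw [hh]; dsimp only; rw [hpi, ← half_split ho hb hu (hne 0) x, h0]
  have hmem : (0 : ℝ) ∈ Set.uIcc (h 0) (h π) := by
    rw [Set.mem_uIcc]
    rcases le_total (h 0) 0 with h1 | h1
    · left; constructor <;> linarith
    · right; constructor <;> linarith
  obtain ⟨θ, -, hθ⟩ := intermediate_value_uIcc hcont.continuousOn hmem
  exact ⟨θ, hθ⟩

/-- Invariant of the localization procedure. -/
def LocInv {d : ℕ} (u f : Euc d → ℝ) (C : Set (Euc d)) : Prop :=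
  IsOpen C ∧ Convex ℝ C ∧ Bornology.IsBounded C ∧ ∫ z in C, u z = 0 ∧ ∫ z in C, f z < 0

lemma loc_step {d : ℕ} {u f : Euc d → ℝ} (hu : Continuous u) (hf : Continuous f) {C : Set (Euc d)}
    (hC : LocInv u f C) (x : Euc d) {i j : Fin d} (hij : i ≠ j) :
    ∃ C' ⊆ C, LocInv u f C' ∧ ∃ m : Euc d, m ≠ 0 ∧ (∀ k, k ≠ i → k ≠ j → m k = 0) ∧
      ∀ z ∈ C', 0 < inner ℝ m (z - x) := by
  obtain ⟨ho, hc, hb, h0, hneg⟩ := hC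
  set n : ℝ → Euc d := fun θ => cos θ • EuclideanSpace.single i (1 : ℝ) + sin θ • EuclideanSpace.single j (1 : ℝ) with hn
  have hni : ∀ θ, n θ i = cos θ := fun θ => by simp [hn, hij]
  have hnj : ∀ θ, n θ j = sin θ := fun θ => by simp [hn, hij.symm]
  have hnk : ∀ θ k, k ≠ i → k ≠ j → n θ k = 0 := fun θ k hi hj => by simp [hn, hi, hj]
  have hne : ∀ θ, n θ ≠ 0 := by
    intro θ h
    have h1 := hni θ
    have h2 := hnj θ
    rw [h] at h1 h2
    have := cos_sq_add_sin_sq θ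
    simp only [PiLp.zero_apply] at h1 h2
    rw [← h1, ← h2] at this; norm_num at this
  obtain ⟨θ, hθ⟩ := bisect ho hb hu h0 x (n := n) (by fun_prop) hne (by simp [hn])
  have hs1 := half_split ho hb hu (hne θ) x
  have hs2 := half_split ho hb hf (hne θ) x
  have hgen : ∀ m : Euc d, LocInv u f (C ∩ {z | 0 < inner ℝ m (z - x)}) ↔
      (∫ z in C ∩ {z | 0 < inner ℝ m (z - x)}, u z = 0 ∧ ∫ z in C ∩ {z | 0 < inner ℝ m (z - x)}, f z < 0) := by
    intro m
    constructor
    · rintro ⟨-, -, -, h⟩; exact h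
    · intro h
      refine ⟨ho.inter (isOpen_lt continuous_const (by fun_prop)), hc.inter ?_, hb.subset Set.inter_subset_left, h⟩
      have : {z : Euc d | 0 < inner ℝ m (z - x)} = {z : Euc d | inner ℝ m x < (innerSL ℝ m) z} := by
        ext z; simp [inner_sub_right]
      rw [this]
      exact convex_halfSpace_gt (innerSL ℝ m).toLinearMap.isLinear _
  by_cases hlt : ∫ z in C ∩ {z | 0 < inner ℝ (n θ) (z - x)}, f z < 0
  · refine ⟨_, Set.inter_subset_left, (hgen (n θ)).2 ⟨hθ, hlt⟩, n θ, hne θ, hnk θ, fun z hz => hz.2⟩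
  · refine ⟨_, Set.inter_subset_left, (hgen (-n θ)).2 ⟨by linarith, by linarith⟩, -n θ, by simpa using hne θ, ?_, fun z hz => hz.2⟩
    intro k h1 h2
    simp [hnk θ k h1 h2]

lemma minor_zero {d : ℕ} {K : Set (Euc d)} {x : ℕ → Euc d} (hx : DenseRange x) {i j : Fin d} (hij : i ≠ j)
    (hK : ∀ k, ∃ m : Euc d, m ≠ 0 ∧ (∀ l, l ≠ i → l ≠ j → m l = 0) ∧ ∀ z ∈ K, 0 ≤ inner ℝ m (z - x k))
    {p q r : Euc d} (hp : p ∈ K) (hq : q ∈ K) (hr : r ∈ K) :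
    (q i - p i) * (r j - p j) = (q j - p j) * (r i - p i) := by
  by_contra hne
  set Δ := (q i - p i) * (r j - p j) - (q j - p j) * (r i - p i) with hΔ
  have hΔ0 : Δ ≠ 0 := sub_ne_zero.2 hne
  set α : Euc d → ℝ := fun z => ((z i - p i) * (r j - p j) - (z j - p j) * (r i - p i)) / Δ with hα
  set β : Euc d → ℝ := fun z => ((q i - p i) * (z j - p j) - (q j - p j) * (z i - p i)) / Δ with hβ
  have hαc : Continuous α := by fun_prop
  have hβc : Continuous β := by fun_prop
  have hopen : IsOpen {z : Euc d | 0 < α z ∧ 0 < β z ∧ α z + β z < 1} :=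
    (isOpen_lt continuous_const hαc).inter ((isOpen_lt continuous_const hβc).inter
      (isOpen_lt (hαc.add hβc) continuous_const))
  have hnon : {z : Euc d | 0 < α z ∧ 0 < β z ∧ α z + β z < 1}.Nonempty := by
    refine ⟨p + (1 / 3 : ℝ) • ((q - p) + (r - p)), ?_⟩
    have h1 : α (p + (1 / 3 : ℝ) • ((q - p) + (r - p))) = 1 / 3 := by
      simp only [hα, PiLp.add_apply, PiLp.smul_apply, PiLp.sub_apply, smul_eq_mul]
      rw [div_eq_iff hΔ0, hΔ]; ring
    have h2 : β (p + (1 / 3 : ℝ) • ((q - p) + (r - p))) = 1 / 3 := by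
      simp only [hβ, PiLp.add_apply, PiLp.smul_apply, PiLp.sub_apply, smul_eq_mul]
      rw [div_eq_iff hΔ0, hΔ]; ring
    simp only [Set.mem_ofPred_eq, h1, h2]; norm_num
  obtain ⟨k, hk⟩ := hx.exists_mem_open hopen hnon
  obtain ⟨hk1, hk2, hk3⟩ := hk
  obtain ⟨m, hm0, hml, hmK⟩ := hK k
  have hinner : ∀ z : Euc d, inner ℝ m (z - x k) = m i * (z i - x k i) + m j * (z j - x k j) := by
    intro z
    rw [PiLp.inner_apply]
    rw [← Finset.sum_subset (Finset.subset_univ {i, j})]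
    · rw [Finset.sum_pair hij]; simp [mul_comm]
    · intro l _ hl
      simp only [Finset.mem_insert, Finset.mem_singleton, not_or] at hl
      simp [hml l hl.1 hl.2]
  have hP := hmK p hp
  have hQ := hmK q hq
  have hR := hmK r hr
  rw [hinner] at hP hQ hR
  have e1 : x k i = p i + α (x k) * (q i - p i) + β (x k) * (r i - p i) := by
    simp only [hα, hβ]
    rw [div_mul_eq_mul_div, div_mul_eq_mul_div, add_assoc, ← add_div, ← sub_eq_iff_eq_add', eq_div_iff hΔ0, hΔ]; ring
  have e2 : x k j = p j + α (x k) * (q j - p j) + β (x k) * (r j - p j) := by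
    simp only [hα, hβ]
    rw [div_mul_eq_mul_div, div_mul_eq_mul_div, add_assoc, ← add_div, ← sub_eq_iff_eq_add', eq_div_iff hΔ0, hΔ]; ring
  set a := α (x k)
  set b := β (x k)
  set P := m i * (p i - x k i) + m j * (p j - x k j) with hPd
  set Q := m i * (q i - x k i) + m j * (q j - x k j) with hQd
  set R := m i * (r i - x k i) + m j * (r j - x k j) with hRd
  have hsum : (1 - a - b) * P + a * Q + b * R = 0 := by
    rw [hPd, hQd, hRd]
    linear_combination (-m i) * e1 + (-m j) * e2
  have t1 : 0 ≤ (1 - a - b) * P := mul_nonneg (by linarith) hP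
  have t2 : 0 ≤ a * Q := mul_nonneg hk1.le hQ
  have t3 : 0 ≤ b * R := mul_nonneg hk2.le hR
  have P0 : P = 0 := (mul_eq_zero.1 (by linarith : (1 - a - b) * P = 0)).resolve_left (by linarith)
  have Q0 : Q = 0 := (mul_eq_zero.1 (by linarith : a * Q = 0)).resolve_left (by linarith)
  have R0 : R = 0 := (mul_eq_zero.1 (by linarith : b * R = 0)).resolve_left (by linarith)
  have f1 : m i * (q i - p i) + m j * (q j - p j) = 0 := by
    have : Q - P = 0 := by rw [P0, Q0]; ring
    rw [← this, hPd, hQd]; ring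
  have f2 : m i * (r i - p i) + m j * (r j - p j) = 0 := by
    have : R - P = 0 := by rw [P0, R0]; ring
    rw [← this, hPd, hRd]; ring
  have g1 : m i * Δ = 0 := by rw [hΔ]; linear_combination (r j - p j) * f1 - (q j - p j) * f2
  have g2 : m j * Δ = 0 := by rw [hΔ]; linear_combination (q i - p i) * f2 - (r i - p i) * f1
  apply hm0
  ext l
  by_cases hli : l = i
  · subst hli; simpa [hΔ0] using g1
  by_cases hlj : l = j
  · subst hlj; simpa [hΔ0] using g2
  simpa using hml l hli hlj

lemma localize {d : ℕ} (hd : 0 < d) {u f : Euc d → ℝ} (hu : Continuous u) (hf : Continuous f) {Ω : Set (Euc d)}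
    (hΩ : LocInv u f Ω) :
    ∃ p e : Euc d, ‖e‖ = 1 ∧ ∀ δ > 0, ∃ C ⊆ Ω, LocInv u f C ∧
      ∀ z ∈ C, ‖(z - p) - (inner ℝ e (z - p) : ℝ) • e‖ < δ := by
  have : Nonempty (Fin d) := ⟨⟨0, hd⟩⟩
  obtain ⟨F, hF⟩ := exists_surjective_nat (ℕ × Fin d × Fin d)
  have step : ∀ (k : ℕ) (C : {C : Set (Euc d) // LocInv u f C}), ∃ C' : {C : Set (Euc d) // LocInv u f C}, C'.1 ⊆ C.1 ∧
      ((F k).2.1 ≠ (F k).2.2 → ∃ m : Euc d, m ≠ 0 ∧ (∀ l, l ≠ (F k).2.1 → l ≠ (F k).2.2 → m l = 0) ∧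
      ∀ z ∈ C'.1, 0 < inner ℝ m (z - TopologicalSpace.denseSeq (Euc d) (F k).1)) := by
    intro k C
    by_cases h : (F k).2.1 ≠ (F k).2.2
    · obtain ⟨C', h1, h2, h3⟩ := loc_step hu hf C.2 (TopologicalSpace.denseSeq (Euc d) (F k).1) h
      exact ⟨⟨C', h2⟩, h1, fun _ => h3⟩
    · exact ⟨C, subset_rfl, fun h' => absurd h' h⟩
  choose G hG1 hG2 using step
  let S : ℕ → {C : Set (Euc d) // LocInv u f C} := fun k => Nat.rec ⟨Ω, hΩ⟩ G k
  have hS : ∀ k, S (k + 1) = G k (S k) := fun k => rfl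
  have hmono : Antitone fun k => (S k).1 := antitone_nat_of_succ_le fun k => by rw [hS]; exact hG1 k _
  have hmonoc : Antitone fun k => closure (S k).1 := fun a b h => closure_mono (hmono h)
  have hcomp : ∀ k, IsCompact (closure (S k).1) := fun k => (S k).2.2.2.1.isCompact_closure
  have hnon : ∀ k, (closure (S k).1).Nonempty := by
    intro k
    rw [closure_nonempty_iff, Set.nonempty_iff_ne_empty]
    intro h
    have := (S k).2.2.2.2.2
    rw [h] at this; simp at this
  set K := ⋂ k, closure (S k).1 with hK
  have hKne : K.Nonempty := IsCompact.nonempty_iInter_of_sequence_nonempty_isCompact_isClosed _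
    (fun k => hmonoc (Nat.le_succ k)) hnon (hcomp 0) (fun k => isClosed_closure)
  have hminor : ∀ i j, ∀ p ∈ K, ∀ q ∈ K, ∀ r ∈ K, (q i - p i) * (r j - p j) = (q j - p j) * (r i - p i) := by
    intro i j p hp q hq r hr
    by_cases hij : i = j
    · subst hij; rfl
    apply minor_zero (TopologicalSpace.denseRange_denseSeq (Euc d)) hij _ hp hq hr
    intro k
    obtain ⟨l, hl⟩ := hF (k, i, j)
    obtain ⟨m, h1, h2, h3⟩ := hG2 l (S l) (by rw [hl]; exact hij)
    refine ⟨m, h1, ?_, ?_⟩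
    · rw [hl] at h2; exact h2
    · intro z hz
      have hz2 : z ∈ closure (S (l + 1)).1 := Set.mem_iInter.1 hz (l + 1)
      rw [hl, ← hS] at h3
      have hcl : IsClosed {z : Euc d | 0 ≤ inner ℝ m (z - TopologicalSpace.denseSeq (Euc d) k)} :=
        isClosed_le continuous_const (by fun_prop)
      exact closure_minimal (fun z hz => (h3 z hz).le) hcl hz2
  obtain ⟨p, hp⟩ := hKne
  have hline : ∃ e : Euc d, ‖e‖ = 1 ∧ ∀ r ∈ K, (r - p) - (inner ℝ e (r - p) : ℝ) • e = 0 := by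
    by_cases hq : ∃ q ∈ K, q ≠ p
    · obtain ⟨q, hq, hqp⟩ := hq
      have hv : ‖q - p‖ ≠ 0 := norm_ne_zero_iff.2 (sub_ne_zero.2 hqp)
      refine ⟨(‖q - p‖⁻¹ : ℝ) • (q - p), by rw [norm_smul, norm_inv, norm_norm, inv_mul_cancel₀ hv], ?_⟩
      intro r hr
      have key : (‖q - p‖ ^ 2) • (r - p) = (inner ℝ (q - p) (r - p) : ℝ) • (q - p) := by
        ext l
        rw [← real_inner_self_eq_norm_sq]
        simp only [PiLp.inner_apply, PiLp.smul_apply, PiLp.sub_apply, smul_eq_mul, Finset.sum_mul, RCLike.inner_apply, conj_trivial]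
        apply Finset.sum_congr rfl
        intro i _
        have := hminor i l p hp q hq r hr
        linear_combination (q i - p i) * this
      rw [real_inner_smul_left, smul_smul, sub_eq_zero]
      have : r - p = (‖q - p‖ ^ 2)⁻¹ • ((‖q - p‖ ^ 2) • (r - p)) := by
        rw [smul_smul, inv_mul_cancel₀ (by positivity), one_smul]
      rw [key, smul_smul] at this
      rw [this]
      congr 1
      rw [← this]
      field_simp
    · push Not at hq
      refine ⟨EuclideanSpace.single ⟨0, hd⟩ (1 : ℝ), by simp, ?_⟩
      intro r hr
      rw [hq r hr]; simp
  obtain ⟨e, he, hKe⟩ := hline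
  refine ⟨p, e, he, ?_⟩
  intro δ hδ
  have hU : IsOpen {z : Euc d | ‖(z - p) - (inner ℝ e (z - p) : ℝ) • e‖ < δ} :=
    isOpen_lt (by fun_prop) continuous_const
  obtain ⟨k, hk⟩ := exists_subset_nhds_of_isCompact' (V := fun k => closure (S k).1)
    (directed_of_isDirected_le fun a b h => hmonoc h) hcomp (fun k => isClosed_closure)
    (U := {z : Euc d | ‖(z - p) - (inner ℝ e (z - p) : ℝ) • e‖ < δ}) (by
      intro z hz
      apply hU.mem_nhds
      simp only [Set.mem_ofPred_eq]
      rw [hKe z hz]; simpa using hδ)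
  exact ⟨(S k).1, hmono (Nat.zero_le k), (S k).2, fun z hz => hk (subset_closure hz)⟩

lemma cont_intOn {d : ℕ} {C : Set (Euc d)} (hb : Bornology.IsBounded C) {g : Euc d → ℝ} (hg : Continuous g) :
    IntegrableOn g C :=
  (hg.continuousOn.integrableOn_compact hb.isCompact_closure).mono_set subset_closure

lemma payne_weinberger {n : ℕ} {Ω : Set (Euc (n + 1))} (ho : IsOpen Ω) (hc : Convex ℝ Ω)
    (hb : Bornology.IsBounded Ω) {D : ℝ} (hD : ∀ x ∈ Ω, ∀ y ∈ Ω, dist x y ≤ D)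
    {u : Euc (n + 1) → ℝ} (hu : ContDiff ℝ (⊤ : ℕ∞) u) (h0 : ∫ x in Ω, u x = 0) :
    (π / D) ^ 2 * ∫ x in Ω, u x ^ 2 ≤ ∫ x in Ω, ‖fderiv ℝ u x‖ ^ 2 := by
  by_contra hcon
  push Not at hcon
  set c := (π / D) ^ 2 with hcdef
  have hc0 : 0 ≤ c := sq_nonneg _
  have huc : Continuous u := hu.continuous
  have hfd : Continuous (fderiv ℝ u) := hu.continuous_fderiv (by simp)
  have hdiff : ∀ x, DifferentiableAt ℝ u x := fun x => hu.differentiable (by simp) x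
  have hi1 : ∀ C : Set (Euc (n + 1)), Bornology.IsBounded C → IntegrableOn (fun x => ‖fderiv ℝ u x‖ ^ 2) C :=
    fun C hC => cont_intOn hC (by fun_prop)
  have hi2 : ∀ C : Set (Euc (n + 1)), Bornology.IsBounded C → IntegrableOn (fun x => u x ^ 2) C :=
    fun C hC => cont_intOn hC (by fun_prop)
  have hf_int : ∀ (C : Set (Euc (n + 1))), Bornology.IsBounded C → ∀ η : ℝ,
      ∫ x in C, (‖fderiv ℝ u x‖ ^ 2 - c * u x ^ 2 + η) = (∫ x in C, ‖fderiv ℝ u x‖ ^ 2) - c * (∫ x in C, u x ^ 2) + η * volume.real C := by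
    intro C hC η
    have h12 : IntegrableOn (fun x => ‖fderiv ℝ u x‖ ^ 2 - c * u x ^ 2) C := cont_intOn hC (by fun_prop)
    have h13 : IntegrableOn (fun _ : Euc (n + 1) => η) C := cont_intOn hC continuous_const
    rw [integral_add h12 h13, integral_sub (hi1 C hC) ((hi2 C hC).const_mul c), integral_const_mul]
    simp [mul_comm]
  set I := c * (∫ x in Ω, u x ^ 2) - ∫ x in Ω, ‖fderiv ℝ u x‖ ^ 2 with hI
  have hI0 : 0 < I := sub_pos.2 hcon
  have hvol0 : 0 ≤ volume.real Ω := measureReal_nonneg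
  set η := I / (volume.real Ω + 1) with hη
  have hη0 : 0 < η := by positivity
  have hηI : η * volume.real Ω < I := by
    rw [hη, div_mul_eq_mul_div, div_lt_iff₀ (by positivity)]
    nlinarith
  have hinv : LocInv u (fun x => ‖fderiv ℝ u x‖ ^ 2 - c * u x ^ 2 + η) Ω := by
    refine ⟨ho, hc, hb, h0, ?_⟩
    rw [hf_int Ω hb η]; linarith
  obtain ⟨p, e, he, hloc⟩ := localize (by omega : 0 < n + 1) huc (by fun_prop) hinv
  obtain ⟨R, hR⟩ := hb.subset_closedBall p
  have hBc : IsCompact (Metric.closedBall p R) := isCompact_closedBall p R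
  set ε := min 1 (η / (2 * c + 1)) with hε
  have hε0 : 0 < ε := lt_min one_pos (by positivity)
  have hε1 : ε ≤ 1 := min_le_left _ _
  have hε2 : ε * (2 * c + 1) ≤ η := by
    have : ε ≤ η / (2 * c + 1) := min_le_right _ _
    rwa [le_div_iff₀ (by positivity)] at this
  have uc : ∀ g : Euc (n + 1) → ℝ, Continuous g → ∃ δ > 0, ∀ x ∈ Metric.closedBall p R, ∀ y ∈ Metric.closedBall p R,
      dist x y < δ → |g x - g y| < ε := by
    intro g hg
    have := Metric.uniformContinuousOn_iff.1 (hBc.uniformContinuousOn_of_continuous hg.continuousOn) ε hε0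
    simpa [Real.dist_eq] using this
  obtain ⟨δ1, hδ1, H1⟩ := uc u huc
  obtain ⟨δ2, hδ2, H2⟩ := uc (fun x => u x ^ 2) (by fun_prop)
  obtain ⟨δ3, hδ3, H3⟩ := uc (fun x => ‖fderiv ℝ u x‖ ^ 2) (by fun_prop)
  obtain ⟨C, hCΩ, ⟨hCo, hCc, hCb, hCu, hCf⟩, hCthin⟩ := hloc (min δ1 (min δ2 δ3)) (by positivity)
  have hCne : C.Nonempty := by
    rw [Set.nonempty_iff_ne_empty]
    intro h
    rw [h] at hCf; simp at hCf
  set v : ℝ → ℝ := fun t => u (p + (t - inner ℝ e p) • e) with hv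
  set v' : ℝ → ℝ := fun t => fderiv ℝ u (p + (t - inner ℝ e p) • e) e with hv'
  have hvd : ∀ t, HasDerivAt v (v' t) t := by
    intro t
    have h1 : HasDerivAt (fun t : ℝ => p + (t - inner ℝ e p) • e) ((1 : ℝ) • e) t :=
      (((hasDerivAt_id t).sub_const _).smul_const e).const_add p
    have := (hdiff (p + (t - inner ℝ e p) • e)).hasFDerivAt.comp_hasDerivAt t h1
    rw [one_smul] at this
    exact this
  have hv'c : Continuous v' := by
    have : Continuous fun t : ℝ => p + (t - inner ℝ e p) • e := by fun_prop
    exact (hfd.comp this).clm_apply continuous_const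
  have hvc : Continuous v := continuous_iff_continuousAt.2 fun t => (hvd t).continuousAt
  have key := needle_euc hCne hCo hCc hCb (fun x hx y hy => hD x (hCΩ hx) y (hCΩ hy)) he hvd hv'c
  rw [← hcdef] at key
  set P : Euc (n + 1) → Euc (n + 1) := fun z => p + (inner ℝ e z - inner ℝ e p : ℝ) • e with hP
  have hPball : ∀ z ∈ C, P z ∈ Metric.closedBall p R := by
    intro z hz
    have hz' := hR (hCΩ hz)
    rw [Metric.mem_closedBall, dist_eq_norm] at hz' ⊢
    simp only [hP, add_sub_cancel_left, norm_smul, he, mul_one, ← inner_sub_right]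
    have := norm_inner_le_norm (𝕜 := ℝ) e (z - p)
    rw [he, one_mul] at this
    linarith
  have hPd : ∀ z ∈ C, dist z (P z) < min δ1 (min δ2 δ3) := by
    intro z hz
    have := hCthin z hz
    have h2 : z - P z = z - p - (inner ℝ e (z - p) : ℝ) • e := by
      rw [inner_sub_right]
      change z - (p + (inner ℝ e z - inner ℝ e p : ℝ) • e) = _
      abel
    rw [dist_eq_norm, h2]
    exact this
  set m := volume.real C with hm
  have hmpos : 0 < m := by
    apply ENNReal.toReal_pos (hCo.measure_pos volume hCne).ne' hCb.measure_lt_top.ne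
  have hconst : ∀ a : ℝ, ∫ z in C, a = a * m := by intro a; simp [hm, mul_comm]
  have hie : Continuous fun z : Euc (n + 1) => (inner ℝ e z : ℝ) := by fun_prop
  have iv : IntegrableOn (fun z => v (inner ℝ e z)) C := cont_intOn hCb (hvc.comp hie)
  have iv2 : IntegrableOn (fun z => v (inner ℝ e z) ^ 2) C := cont_intOn hCb ((hvc.comp hie).pow 2)
  have iv3 : IntegrableOn (fun z => v' (inner ℝ e z) ^ 2) C := cont_intOn hCb ((hv'c.comp hie).pow 2)
  have iu : IntegrableOn u C := cont_intOn hCb huc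
  have iε : IntegrableOn (fun _ : Euc (n + 1) => ε) C := cont_intOn hCb continuous_const
  have A1 : ∫ z in C, v' (inner ℝ e z) ^ 2 ≤ (∫ z in C, ‖fderiv ℝ u z‖ ^ 2) + ε * m := by
    rw [← hconst, ← integral_add (hi1 C hCb) iε]
    apply setIntegral_mono_on iv3 ((hi1 C hCb).add iε) hCo.measurableSet
    intro z hz
    have h3 := H3 z (hR (hCΩ hz)) (P z) (hPball z hz) ((hPd z hz).trans_le ((min_le_right _ _).trans (min_le_right _ _)))
    have h4 : v' (inner ℝ e z) ^ 2 ≤ ‖fderiv ℝ u (P z)‖ ^ 2 := by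
      have := (fderiv ℝ u (P z)).le_opNorm e
      rw [he, mul_one, Real.norm_eq_abs] at this
      rw [← sq_abs]
      gcongr
    rw [abs_lt] at h3
    change _ ≤ ‖fderiv ℝ u z‖ ^ 2 + ε
    linarith [h3.1]
  have A2 : ∫ z in C, u z ^ 2 ≤ (∫ z in C, v (inner ℝ e z) ^ 2) + ε * m := by
    rw [← hconst, ← integral_add iv2 iε]
    apply setIntegral_mono_on (hi2 C hCb) (iv2.add iε) hCo.measurableSet
    intro z hz
    have h3 := H2 z (hR (hCΩ hz)) (P z) (hPball z hz) ((hPd z hz).trans_le ((min_le_right _ _).trans (min_le_left _ _)))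
    rw [abs_lt] at h3
    have h4 : v (inner ℝ e z) = u (P z) := rfl
    change _ ≤ v (inner ℝ e z) ^ 2 + ε
    rw [h4]
    linarith [h3.2]
  have A3 : |∫ z in C, v (inner ℝ e z)| ≤ ε * m := by
    have : ∫ z in C, v (inner ℝ e z) = ∫ z in C, (v (inner ℝ e z) - u z) := by
      rw [integral_sub iv iu, hCu, sub_zero]
    rw [this, hm, ← Real.norm_eq_abs]
    apply norm_setIntegral_le_of_norm_le_const hCb.measure_lt_top
    intro z hz
    have h3 := H1 z (hR (hCΩ hz)) (P z) (hPball z hz) ((hPd z hz).trans_le (min_le_left _ _))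
    rw [Real.norm_eq_abs, abs_sub_comm]
    exact h3.le
  rw [hf_int C hCb η] at hCf
  set X := ∫ z in C, v (inner ℝ e z) ^ 2
  set Y := ∫ z in C, v (inner ℝ e z)
  set Z := ∫ z in C, v' (inner ℝ e z) ^ 2
  set U := ∫ z in C, u z ^ 2
  set W := ∫ z in C, ‖fderiv ℝ u z‖ ^ 2
  have hY : Y ^ 2 ≤ (ε * m) ^ 2 := sq_le_sq' (by linarith [neg_abs_le Y]) ((le_abs_self Y).trans A3)
  have B1 : c * ((U - ε * m) * m - (ε * m) ^ 2) ≤ (W + ε * m) * m := by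
    have e1 : c * ((U - ε * m) * m - (ε * m) ^ 2) ≤ c * (X * m - Y ^ 2) := by
      apply mul_le_mul_of_nonneg_left _ hc0
      have : (U - ε * m) * m ≤ X * m := mul_le_mul_of_nonneg_right (by linarith) hmpos.le
      linarith
    have e2 : Z * m ≤ (W + ε * m) * m := mul_le_mul_of_nonneg_right A1 hmpos.le
    linarith
  have B2 : c * (U - ε * m - ε ^ 2 * m) ≤ W + ε * m := by
    apply le_of_mul_le_mul_right _ hmpos
    linarith
  have B3 : ε ^ 2 ≤ ε := by nlinarith
  have B4 : c * (ε ^ 2 * m) ≤ c * (ε * m) := by gcongr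
  have B5 : ε * (2 * c + 1) * m ≤ η * m := mul_le_mul_of_nonneg_right hε2 hmpos.le
  linarith

lemma rayleigh_nonneg {d : ℕ} (Ω : Set (Euc d)) (u : Euc d → ℝ) : 0 ≤ rayleigh Ω u :=
  div_nonneg (integral_nonneg fun _ => by positivity) (integral_nonneg fun _ => by positivity)

lemma rsup_nonneg {d : ℕ} (Ω : Set (Euc d)) (V : Submodule ℝ (Euc d → ℝ)) :
    0 ≤ sSup { r : ℝ | ∃ u ∈ V, (0 < ∫ x in Ω, (u x) ^ 2) ∧ r = rayleigh Ω u } := by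
  apply Real.sSup_nonneg
  rintro r ⟨u, -, -, rfl⟩
  exact rayleigh_nonneg Ω u

lemma neumann_nonneg {d : ℕ} (k : ℕ) (Ω : Set (Euc d)) : 0 ≤ neumannEigenvalue k Ω := by
  apply Real.sInf_nonneg
  rintro r ⟨V, -, -, rfl⟩
  exact rsup_nonneg Ω V

lemma span_pair_prop {d : ℕ} {Ω : Set (Euc d)} {u1 u2 : Euc d → ℝ} (h1 : ContDiff ℝ (⊤ : ℕ∞) u1)
    (h2 : ContDiff ℝ (⊤ : ℕ∞) u2) (hli : ∀ a b : ℝ, (∀ x ∈ Ω, a * u1 x + b * u2 x = 0) → a = 0 ∧ b = 0) :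
    (∀ u ∈ Submodule.span ℝ {u1, u2}, ContDiff ℝ (⊤ : ℕ∞) u) ∧
    Module.finrank ℝ ((Submodule.span ℝ {u1, u2}).map (LinearMap.funLeft ℝ ℝ ((↑) : Ω → Euc d))) = 1 + 1 := by
  constructor
  · intro u hu
    obtain ⟨a, b, rfl⟩ := Submodule.mem_span_pair.1 hu
    exact (h1.const_smul a).add (h2.const_smul b)
  · set L := LinearMap.funLeft ℝ ℝ ((↑) : Ω → Euc d) with hL
    have hli' : LinearIndependent ℝ ![L u1, L u2] := by
      rw [LinearIndependent.pair_iff]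
      intro a b hab
      apply hli a b
      intro x hx
      have := congrFun hab ⟨x, hx⟩
      simpa [hL, LinearMap.funLeft_apply] using this
    have := finrank_span_eq_card hli'
    rw [Matrix.range_cons, Matrix.range_cons, Matrix.range_empty, Set.union_empty, Set.singleton_union] at this
    rw [Submodule.map_span, Set.image_pair]
    simpa using this

lemma sq_int_pos {d : ℕ} {Ω : Set (Euc d)} (ho : IsOpen Ω) (hb : Bornology.IsBounded Ω) {u : Euc d → ℝ}
    (hu : Continuous u) (hne : ¬ ∀ x ∈ Ω, u x = 0) : 0 < ∫ x in Ω, u x ^ 2 := by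
  push Not at hne
  obtain ⟨x, hx, hx0⟩ := hne
  rw [setIntegral_pos_iff_support_of_nonneg_ae (Eventually.of_forall fun _ => by positivity) (cont_intOn hb (by fun_prop))]
  apply IsOpen.measure_pos
  · exact IsOpen.inter (by
      have : Continuous fun x => u x ^ 2 := by fun_prop
      exact this.isOpen_support) ho
  · exact ⟨x, by simpa using hx0, hx⟩

lemma quad_int {d : ℕ} {Ω : Set (Euc d)} (hb : Bornology.IsBounded Ω) {u1 u2 : Euc d → ℝ}
    (h1 : Continuous u1) (h2 : Continuous u2) (a b : ℝ) :
    ∫ x in Ω, (a * u1 x + b * u2 x) ^ 2 = a ^ 2 * (∫ x in Ω, u1 x ^ 2) + 2 * a * b * (∫ x in Ω, u1 x * u2 x)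
      + b ^ 2 * ∫ x in Ω, u2 x ^ 2 := by
  have i1 : IntegrableOn (fun x => a ^ 2 * u1 x ^ 2) Ω := cont_intOn hb (by fun_prop)
  have i2 : IntegrableOn (fun x => 2 * a * b * (u1 x * u2 x)) Ω := cont_intOn hb (by fun_prop)
  have i3 : IntegrableOn (fun x => b ^ 2 * u2 x ^ 2) Ω := cont_intOn hb (by fun_prop)
  have i12 : IntegrableOn (fun x => a ^ 2 * u1 x ^ 2 + 2 * a * b * (u1 x * u2 x)) Ω := cont_intOn hb (by fun_prop)
  rw [← integral_const_mul, ← integral_const_mul, ← integral_const_mul, ← integral_add i1 i2, ← integral_add i12 i3]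
  congr 1
  ext x; ring

lemma neumann_lower {d : ℕ} (hd : 0 < d) {Ω : Set (Euc d)} (hΩ : IsConvexDomain Ω) {c : ℝ}
    (hc : ∀ u : Euc d → ℝ, ContDiff ℝ (⊤ : ℕ∞) u → ∫ x in Ω, u x = 0 →
      c * ∫ x in Ω, u x ^ 2 ≤ ∫ x in Ω, ‖fderiv ℝ u x‖ ^ 2) : c ≤ neumannEigenvalue 1 Ω := by
  obtain ⟨hne, ho, hb, -⟩ := hΩ
  apply le_csInf
  · have h1 : ContDiff ℝ (⊤ : ℕ∞) (fun _ : Euc d => (1 : ℝ)) := contDiff_const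
    have h2 : ContDiff ℝ (⊤ : ℕ∞) (fun x : Euc d => x ⟨0, hd⟩) := by fun_prop
    obtain ⟨p1, p2⟩ := span_pair_prop (Ω := Ω) h1 h2 (by
      intro a b hab
      obtain ⟨x, hx⟩ := hne
      obtain ⟨ε, hε, hball⟩ := Metric.isOpen_iff.1 ho x hx
      have hy : x + (ε / 2) • EuclideanSpace.single ⟨0, hd⟩ (1 : ℝ) ∈ Ω := by
        apply hball
        simp [norm_smul, abs_of_pos hε, hε]
      have e1 := hab x hx
      have e2 := hab _ hy
      simp at e1 e2
      have : b * (ε / 2) = 0 := by linarith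
      have hb0 : b = 0 := (mul_eq_zero.1 this).resolve_right (by positivity)
      subst hb0
      simp at e1
      exact ⟨e1, rfl⟩)
    exact ⟨_, _, p1, p2, rfl⟩
  · rintro t ⟨V, hV, hfr, rfl⟩
    set L := LinearMap.funLeft ℝ ℝ ((↑) : Ω → Euc d) with hL
    have : Module.Finite ℝ (V.map L) := Module.finite_of_finrank_pos (by omega)
    let bas := Module.finBasisOfFinrankEq ℝ (V.map L) hfr
    obtain ⟨u1, hu1V, hu1⟩ := (bas 0).2
    obtain ⟨u2, hu2V, hu2⟩ := (bas 1).2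
    have s1 := hV u1 hu1V
    have s2 := hV u2 hu2V
    have c1 := s1.continuous
    have c2 := s2.continuous
    have hrep : ∀ u ∈ V, ∃ a b : ℝ, ∀ x ∈ Ω, u x = a * u1 x + b * u2 x := by
      intro u hu
      have hsum := bas.sum_repr ⟨L u, Submodule.mem_map_of_mem hu⟩
      refine ⟨bas.repr ⟨L u, Submodule.mem_map_of_mem hu⟩ 0, bas.repr ⟨L u, Submodule.mem_map_of_mem hu⟩ 1, ?_⟩
      intro x hx
      have h3 := congrFun (congrArg Subtype.val hsum) ⟨x, hx⟩
      rw [Fin.sum_univ_two] at h3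
      simp only [Submodule.coe_add, Submodule.coe_smul, ← hu1, ← hu2] at h3
      simpa [hL, LinearMap.funLeft_apply] using h3.symm
    have hli : ∀ a b : ℝ, (∀ x ∈ Ω, a * u1 x + b * u2 x = 0) → a = 0 ∧ b = 0 := by
      intro a b hab
      have hlin := bas.linearIndependent
      have h4 := (Fintype.linearIndependent_iff.1 hlin) ![a, b] (by
        rw [Fin.sum_univ_two]
        apply Subtype.ext
        simp only [Submodule.coe_add, Submodule.coe_smul, ← hu1, ← hu2]
        ext ⟨x, hx⟩
        simpa [hL, LinearMap.funLeft_apply] using hab x hx)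
      exact ⟨by simpa using h4 0, by simpa using h4 1⟩
    have hpos : ∀ a b : ℝ, (a ≠ 0 ∨ b ≠ 0) → 0 < ∫ x in Ω, (a * u1 x + b * u2 x) ^ 2 := by
      intro a b hab
      apply sq_int_pos ho hb (by fun_prop)
      intro h
      have := hli a b h
      tauto
    have hq := fun a b => quad_int hb c1 c2 a b
    set b11 := ∫ x in Ω, u1 x ^ 2 with hb11
    set b12 := ∫ x in Ω, u1 x * u2 x with hb12
    set b22 := ∫ x in Ω, u2 x ^ 2 with hb22
    have hb11p : 0 < b11 := by have := hpos 1 0 (by simp); rw [hq] at this; linarith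
    have hb22p : 0 < b22 := by have := hpos 0 1 (by simp); rw [hq] at this; linarith
    have hΔ : 0 < b11 * b22 - b12 ^ 2 := by
      have := hpos b22 (-b12) (Or.inl hb22p.ne')
      rw [hq] at this
      have h5 : 0 < b22 * (b11 * b22 - b12 ^ 2) := by linarith
      exact (mul_pos_iff_of_pos_left hb22p).1 h5
    set Δ := b11 * b22 - b12 ^ 2 with hΔd
    set A1 := ∫ x in Ω, ‖fderiv ℝ u1 x‖ ^ 2 with hA1
    set A2 := ∫ x in Ω, ‖fderiv ℝ u2 x‖ ^ 2 with hA2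
    have hA1n : 0 ≤ A1 := integral_nonneg fun _ => by positivity
    have hA2n : 0 ≤ A2 := integral_nonneg fun _ => by positivity
    have hbdd : BddAbove { r : ℝ | ∃ u ∈ V, (0 < ∫ x in Ω, (u x) ^ 2) ∧ r = rayleigh Ω u } := by
      refine ⟨2 * (A1 * b22 + A2 * b11) / Δ, ?_⟩
      rintro r ⟨u, huV, hup, rfl⟩
      rw [rayleigh, div_le_iff₀ hup]
      obtain ⟨a, b, hab⟩ := hrep u huV
      have hB : ∫ x in Ω, u x ^ 2 = a ^ 2 * b11 + 2 * a * b * b12 + b ^ 2 * b22 := by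
        rw [← hq]
        apply setIntegral_congr_fun ho.measurableSet
        intro x hx
        dsimp only
        rw [hab x hx]
      have hfd1 : Continuous (fderiv ℝ u1) := s1.continuous_fderiv (by simp)
      have hfd2 : Continuous (fderiv ℝ u2) := s2.continuous_fderiv (by simp)
      have hfd : Continuous (fderiv ℝ u) := (hV u huV).continuous_fderiv (by simp)
      have hA : ∫ x in Ω, ‖fderiv ℝ u x‖ ^ 2 ≤ 2 * a ^ 2 * A1 + 2 * b ^ 2 * A2 := by
        have i1 : IntegrableOn (fun x => 2 * a ^ 2 * ‖fderiv ℝ u1 x‖ ^ 2) Ω := cont_intOn hb (by fun_prop)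
        have i2 : IntegrableOn (fun x => 2 * b ^ 2 * ‖fderiv ℝ u2 x‖ ^ 2) Ω := cont_intOn hb (by fun_prop)
        rw [hA1, hA2, ← integral_const_mul, ← integral_const_mul, ← integral_add i1 i2]
        apply setIntegral_mono_on (cont_intOn hb (by fun_prop)) (i1.add i2) ho.measurableSet
        intro x hx
        change _ ≤ 2 * a ^ 2 * ‖fderiv ℝ u1 x‖ ^ 2 + 2 * b ^ 2 * ‖fderiv ℝ u2 x‖ ^ 2
        have hev : u =ᶠ[nhds x] fun x => a * u1 x + b * u2 x := by
          filter_upwards [ho.mem_nhds hx] with y hy using hab y hy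
        have d1 : DifferentiableAt ℝ u1 x := s1.differentiable (by simp) x
        have d2 : DifferentiableAt ℝ u2 x := s2.differentiable (by simp) x
        have : fderiv ℝ u x = a • fderiv ℝ u1 x + b • fderiv ℝ u2 x := by
          rw [hev.fderiv_eq]
          exact ((d1.hasFDerivAt.const_mul a).add (d2.hasFDerivAt.const_mul b)).fderiv
        have hn : ‖fderiv ℝ u x‖ ≤ |a| * ‖fderiv ℝ u1 x‖ + |b| * ‖fderiv ℝ u2 x‖ := by
          rw [this]
          refine (norm_add_le _ _).trans ?_
          rw [norm_smul, norm_smul, Real.norm_eq_abs, Real.norm_eq_abs]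
        calc ‖fderiv ℝ u x‖ ^ 2 ≤ (|a| * ‖fderiv ℝ u1 x‖ + |b| * ‖fderiv ℝ u2 x‖) ^ 2 := by gcongr
          _ ≤ 2 * (|a| * ‖fderiv ℝ u1 x‖) ^ 2 + 2 * (|b| * ‖fderiv ℝ u2 x‖) ^ 2 := by
            nlinarith [sq_nonneg (|a| * ‖fderiv ℝ u1 x‖ - |b| * ‖fderiv ℝ u2 x‖)]
          _ = _ := by rw [mul_pow, mul_pow, sq_abs, sq_abs]; ring
      set B := ∫ x in Ω, u x ^ 2 with hBd
      have k1 : Δ * a ^ 2 ≤ B * b22 := by rw [hB, hΔd]; nlinarith [sq_nonneg (a * b12 + b * b22)]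
      have k2 : Δ * b ^ 2 ≤ B * b11 := by rw [hB, hΔd]; nlinarith [sq_nonneg (b * b12 + a * b11)]
      refine hA.trans ?_
      rw [div_mul_eq_mul_div, le_div_iff₀ hΔ]
      have k3 := mul_le_mul_of_nonneg_right k1 hA1n
      have k4 := mul_le_mul_of_nonneg_right k2 hA2n
      linarith
    obtain ⟨a, b, hab, hab0⟩ : ∃ a b : ℝ, (a ≠ 0 ∨ b ≠ 0) ∧ a * (∫ x in Ω, u1 x) + b * (∫ x in Ω, u2 x) = 0 := by
      by_cases h : ∫ x in Ω, u1 x = 0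
      · exact ⟨1, 0, by simp, by simp [h]⟩
      · exact ⟨∫ x in Ω, u2 x, -∫ x in Ω, u1 x, Or.inr (neg_ne_zero.2 h), by ring⟩
    have hw := hpos a b hab
    have hmem : (fun x => a * u1 x + b * u2 x) ∈ V := V.add_mem (V.smul_mem a hu1V) (V.smul_mem b hu2V)
    have hw0 : ∫ x in Ω, (a * u1 x + b * u2 x) = 0 := by
      have i1 : IntegrableOn (fun x => a * u1 x) Ω := cont_intOn hb (by fun_prop)
      have i2 : IntegrableOn (fun x => b * u2 x) Ω := cont_intOn hb (by fun_prop)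
      rw [integral_add i1 i2, integral_const_mul, integral_const_mul, hab0]
    have hfin := hc _ (hV _ hmem) hw0
    refine le_trans ?_ (le_csSup hbdd ⟨_, hmem, hw, rfl⟩)
    rw [rayleigh, le_div_iff₀ hw]
    exact hfin

lemma neumann_lower_diam {d : ℕ} (hd : 0 < d) {Ω : Set (Euc d)} (hΩ : IsConvexDomain Ω) {D : ℝ}
    (hD : ∀ x ∈ Ω, ∀ y ∈ Ω, dist x y ≤ D) : (π / D) ^ 2 ≤ neumannEigenvalue 1 Ω := by
  apply neumann_lower hd hΩ
  obtain ⟨n, rfl⟩ : ∃ n, d = n + 1 := ⟨d - 1, by omega⟩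
  intro u hu h0
  exact payne_weinberger hΩ.2.1 hΩ.2.2.2 hΩ.2.2.1 hD hu h0

/-- Coefficients of the normalized Bessel series. -/
def bC (a : ℝ) (m : ℕ) : ℝ := (-1 / 4 : ℝ) ^ m / (m.factorial * Real.Gamma (m + a))

/-- Normalized Bessel function. -/
def bF (a : ℝ) (t : ℝ) : ℝ := ∑' m : ℕ, bC a m * t ^ m

lemma gamma_ge {a : ℝ} (ha : 1 ≤ a) (m : ℕ) : Real.Gamma a ≤ Real.Gamma (m + a) := by
  induction m with
  | zero => simp
  | succ k ih =>
    have hk : (0 : ℝ) ≤ k := Nat.cast_nonneg k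
    have : ((k + 1 : ℕ) : ℝ) + a = (k + a) + 1 := by push_cast; ring
    rw [this, Real.Gamma_add_one (by linarith)]
    have h1 : 0 < Real.Gamma (k + a) := Real.Gamma_pos_of_pos (by linarith)
    nlinarith

lemma bC_bound {a : ℝ} (ha : 1 ≤ a) (m : ℕ) : |bC a m| ≤ (Real.Gamma a)⁻¹ * (1 / m.factorial) := by
  have h0 : 0 < Real.Gamma a := Real.Gamma_pos_of_pos (by linarith)
  have h1 := gamma_ge ha m
  have h2 : 0 < Real.Gamma (m + a) := h0.trans_le h1
  have hf : (0 : ℝ) < m.factorial := by exact_mod_cast Nat.factorial_pos m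
  rw [bC, abs_div, abs_pow, abs_of_pos (mul_pos hf h2)]
  have h3 : |(-1 / 4 : ℝ)| ^ m ≤ 1 := pow_le_one₀ (abs_nonneg _) (by rw [abs_le]; norm_num)
  calc |(-1 / 4 : ℝ)| ^ m / (m.factorial * Real.Gamma (m + a)) ≤ 1 / (m.factorial * Real.Gamma a) := by gcongr
    _ = _ := by field_simp

lemma bF_summable {a : ℝ} (ha : 1 ≤ a) (t : ℝ) : Summable fun m => bC a m * t ^ m := by
  have h0 : 0 < Real.Gamma a := Real.Gamma_pos_of_pos (by linarith)
  refine Summable.of_norm_bounded (g := fun m => (Real.Gamma a)⁻¹ * (|t| ^ m / m.factorial))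
    ((Real.summable_pow_div_factorial |t|).mul_left _) ?_
  intro m
  rw [norm_mul, norm_pow, Real.norm_eq_abs, Real.norm_eq_abs]
  have := mul_le_mul_of_nonneg_right (bC_bound ha m) (by positivity : 0 ≤ |t| ^ m)
  calc _ ≤ _ := this
    _ = _ := by ring

lemma bC_succ {a : ℝ} (m : ℕ) : bC a (m + 1) * (m + 1 : ℝ) = -1 / 4 * bC (a + 1) m := by
  have hf : (m.factorial : ℝ) ≠ 0 := by exact_mod_cast Nat.factorial_ne_zero m
  have hm : (m + 1 : ℝ) ≠ 0 := by positivity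
  have e : ((m + 1 : ℕ) : ℝ) + a = m + (a + 1) := by push_cast; ring
  rw [bC, bC, Nat.factorial_succ, e, pow_succ]
  push_cast
  rw [div_mul_eq_mul_div, mul_div_assoc', mul_assoc (m + 1 : ℝ), mul_comm (m + 1 : ℝ) (_ * _), mul_div_mul_right _ _ hm]
  ring

lemma bF_hasDerivAt {a : ℝ} (ha : 1 ≤ a) (t : ℝ) : HasDerivAt (bF a) (-1 / 4 * bF (a + 1) t) t := by
  have h0 : 0 < Real.Gamma a := Real.Gamma_pos_of_pos (by linarith)
  set R := |t| + 1 with hR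
  have hR0 : 0 < R := by positivity
  have hsum : Summable fun m : ℕ => (Real.Gamma a)⁻¹ * (1 / m.factorial) * (m * R ^ (m - 1)) := by
    rw [← summable_nat_add_iff 1]
    have : (fun m : ℕ => (Real.Gamma a)⁻¹ * (1 / (m + 1).factorial) * ((m + 1 : ℕ) * R ^ (m + 1 - 1))) =
        fun m : ℕ => (Real.Gamma a)⁻¹ * (R ^ m / m.factorial) := by
      ext m
      rw [Nat.factorial_succ, Nat.add_sub_cancel]
      push_cast
      field_simp
    rw [this]
    exact (Real.summable_pow_div_factorial R).mul_left _
  have key := hasDerivAt_tsum_of_isPreconnected (g := fun m t => bC a m * t ^ m)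
    (g' := fun m t => bC a m * (m * t ^ (m - 1))) (t := Metric.ball (0 : ℝ) R) hsum Metric.isOpen_ball
    (convex_ball (0 : ℝ) R).isPreconnected
    (fun m y _ => (hasDerivAt_pow m y).const_mul _)
    (by
      intro m y hy
      rw [mem_ball_zero_iff, Real.norm_eq_abs] at hy
      rw [norm_mul, norm_mul, norm_pow, Real.norm_eq_abs, Real.norm_eq_abs, Real.norm_eq_abs, abs_of_nonneg (Nat.cast_nonneg m : (0 : ℝ) ≤ m)]
      gcongr
      exact bC_bound ha m)
    (Metric.mem_ball_self hR0) (bF_summable ha 0) (by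
      rw [mem_ball_zero_iff, Real.norm_eq_abs]; linarith : t ∈ Metric.ball (0 : ℝ) R)
  refine (show HasDerivAt (bF a) _ t from key).congr_deriv ?_
  symm
  have hs' : Summable fun m : ℕ => bC a m * (m * t ^ (m - 1)) := by
    refine Summable.of_norm_bounded hsum ?_
    intro m
    rw [norm_mul, norm_mul, norm_pow, Real.norm_eq_abs, Real.norm_eq_abs, Real.norm_eq_abs, abs_of_nonneg (Nat.cast_nonneg m : (0 : ℝ) ≤ m)]
    gcongr
    · exact bC_bound ha m
    · linarith
  rw [hs'.tsum_eq_zero_add]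
  simp only [Nat.cast_zero, zero_mul, mul_zero, zero_add, Nat.add_sub_cancel]
  rw [bF, ← tsum_mul_left]
  congr 1
  ext m
  push_cast
  rw [← mul_assoc (bC a (m + 1)), bC_succ]; ring

lemma bF_contDiff {a : ℝ} (ha : 1 ≤ a) : ContDiff ℝ (⊤ : ℕ∞) (bF a) := by
  have : ∀ n : ℕ, ∀ a : ℝ, 1 ≤ a → ContDiff ℝ n (bF a) := by
    intro n
    induction n with
    | zero =>
      intro a ha
      exact contDiff_zero.2 (continuous_iff_continuousAt.2 fun t => (bF_hasDerivAt ha t).continuousAt)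
    | succ n ih =>
      intro a ha
      push_cast
      rw [contDiff_succ_iff_deriv]
      refine ⟨fun t => (bF_hasDerivAt ha t).differentiableAt, by simp, ?_⟩
      have : deriv (bF a) = fun t => -1 / 4 * bF (a + 1) t := funext fun t => (bF_hasDerivAt ha t).deriv
      rw [this]
      exact contDiff_const.mul (ih (a + 1) (by linarith))
  exact contDiff_infty.2 fun n => this n a ha

lemma bF_continuous {a : ℝ} (ha : 1 ≤ a) : Continuous (bF a) := (bF_contDiff ha).continuous

lemma bF_rec {a : ℝ} (ha : 1 ≤ a) (t : ℝ) : bF a t = a * bF (a + 1) t + t * (-1 / 4 * bF (a + 2) t) := by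
  have e1 : ∀ m : ℕ, bC a m = (m + a) * bC (a + 1) m := by
    intro m
    have hm : (0 : ℝ) ≤ m := Nat.cast_nonneg m
    have h : (m : ℝ) + a ≠ 0 := by linarith
    have h2 : Real.Gamma (m + a) ≠ 0 := (Real.Gamma_pos_of_pos (by linarith)).ne'
    have hf : (m.factorial : ℝ) ≠ 0 := by exact_mod_cast Nat.factorial_ne_zero m
    rw [bC, bC, ← add_assoc, Real.Gamma_add_one h]
    field_simp
  have s1 := bF_summable (a := a + 1) (by linarith) t
  have s2 := bF_summable (a := a + 2) (by linarith) t
  have s0 := bF_summable ha t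
  have s3 : Summable fun m : ℕ => (m : ℝ) * bC (a + 1) m * t ^ m := by
    have := s0.sub (s1.mul_left a)
    refine this.congr fun m => ?_
    rw [e1 m]; ring
  have h3 : ∑' m : ℕ, (m : ℝ) * bC (a + 1) m * t ^ m = t * (-1 / 4 * bF (a + 2) t) := by
    rw [s3.tsum_eq_zero_add]
    simp only [Nat.cast_zero, zero_mul, zero_add]
    rw [bF, ← tsum_mul_left, ← tsum_mul_left]
    congr 1
    ext m
    have := bC_succ (a := a + 1) m
    rw [add_assoc, one_add_one_eq_two] at this
    push_cast
    rw [pow_succ]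
    linear_combination (t ^ m * t) * this
  rw [← h3, bF, bF, ← tsum_mul_left, ← (s1.mul_left a).tsum_add s3]
  congr 1
  ext m
  rw [e1 m]; ring

lemma bF_zero {a : ℝ} (ha : 1 ≤ a) : 0 < bF a 0 := by
  have : bF a 0 = bC a 0 := by
    rw [bF, tsum_eq_single 0]
    · simp
    · intro m hm; simp [hm]
  rw [this, bC]
  have h0 : 0 < Real.Gamma a := Real.Gamma_pos_of_pos (by linarith)
  simpa using h0

lemma besselJ_eq {ν x : ℝ} (hx : 0 < x) : besselJ ν x = (x / 2) ^ ν * bF (ν + 1) (x ^ 2) := by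
  rw [besselJ, bF, ← tsum_mul_left]
  congr 1
  ext m
  have hx2 : 0 < x / 2 := by positivity
  rw [Real.rpow_add hx2, bC, add_assoc]
  have : (x / 2) ^ (2 * (m : ℝ)) = ((1 : ℝ) / 4) ^ m * (x ^ 2) ^ m := by
    rw [Real.rpow_mul hx2.le, Real.rpow_natCast, ← mul_pow]
    congr 1
    rw [Real.rpow_two]; ring
  rw [this]
  have h4 : (-1 / 4 : ℝ) ^ m = (-1) ^ m * (1 / 4) ^ m := by rw [← mul_pow]; norm_num
  rw [h4]
  ring

lemma bessel_facts {a : ℝ} (ha : 1 ≤ a) {j : ℝ} (hj : j = besselZero1 (a - 1)) (hj0 : 0 < j) :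
    bF a (j ^ 2) = 0 ∧ ∀ r, 0 ≤ r → r < j → 0 < bF a (r ^ 2) := by
  have hset : {x : ℝ | 0 < x ∧ besselJ (a - 1) x = 0} = {x : ℝ | 0 < x ∧ bF a (x ^ 2) = 0} := by
    ext x
    simp only [Set.mem_ofPred_eq]
    refine and_congr_right fun hx => ?_
    rw [besselJ_eq hx, sub_add_cancel]
    have : 0 < (x / 2) ^ (a - 1) := by positivity
    simp [this.ne']
  rw [besselZero1, hset] at hj
  have hcont : Continuous fun x : ℝ => bF a (x ^ 2) := (bF_continuous ha).comp (by fun_prop)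
  have hne : {x : ℝ | 0 < x ∧ bF a (x ^ 2) = 0}.Nonempty := by
    by_contra h
    rw [Set.not_nonempty_iff_eq_empty] at h
    rw [h, Real.sInf_empty] at hj
    linarith
  have hbb : BddBelow {x : ℝ | 0 < x ∧ bF a (x ^ 2) = 0} := ⟨0, fun x hx => hx.1.le⟩
  constructor
  · have h1 := csInf_mem_closure hne hbb
    rw [← hj] at h1
    have hcl : IsClosed {x : ℝ | bF a (x ^ 2) = 0} := isClosed_eq hcont continuous_const
    exact closure_minimal (fun x hx => hx.2) hcl h1
  · intro r hr0 hrj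
    have hnz : ∀ s, 0 ≤ s → s < j → bF a (s ^ 2) ≠ 0 := by
      intro s hs hsj h
      rcases hs.eq_or_lt with rfl | hs
      · have := bF_zero ha
        simp at h; linarith
      · rw [hj] at hsj
        exact notMem_of_lt_csInf hsj hbb ⟨hs, h⟩
    by_contra hcon
    push Not at hcon
    have hz := bF_zero ha
    obtain ⟨s, hs, hs0⟩ := intermediate_value_Icc' hr0 (f := fun x : ℝ => bF a (x ^ 2)) hcont.continuousOn
      (show (0 : ℝ) ∈ Set.Icc _ _ from ⟨hcon, by simpa using hz.le⟩)
    exact hnz s hs.1 (hs.2.trans_lt hrj) hs0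

/-- Radial Wronskian-type primitive. -/
lemma radial_deriv {d : ℕ} (hd : 2 ≤ d) (r : ℝ) :
    HasDerivAt (fun r : ℝ => r ^ d * bF ((d : ℝ) / 2 + 1) (r ^ 2)) (2 * r ^ (d - 1) * bF ((d : ℝ) / 2) (r ^ 2)) r := by
  have hd' : (2 : ℝ) ≤ d := by exact_mod_cast hd
  have ha : (1 : ℝ) ≤ (d : ℝ) / 2 := by linarith
  have h1 : HasDerivAt (fun r : ℝ => bF ((d : ℝ) / 2 + 1) (r ^ 2)) (-1 / 4 * bF ((d : ℝ) / 2 + 1 + 1) (r ^ 2) * (2 * r)) r := by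
    have := (bF_hasDerivAt (a := (d : ℝ) / 2 + 1) (by linarith) (r ^ 2)).comp r (hasDerivAt_pow 2 r)
    refine (show HasDerivAt (fun r : ℝ => bF ((d : ℝ) / 2 + 1) (r ^ 2)) _ r from this).congr_deriv ?_
    simp
  have h2 := (hasDerivAt_pow d r).mul h1
  refine (show HasDerivAt (fun r : ℝ => r ^ d * bF ((d : ℝ) / 2 + 1) (r ^ 2)) _ r from h2).congr_deriv ?_
  symm
  rw [bF_rec ha]
  obtain ⟨k, rfl⟩ : ∃ k, d = k + 1 := ⟨d - 1, by omega⟩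
  rw [Nat.add_sub_cancel, add_assoc _ (1 : ℝ) 1, one_add_one_eq_two, pow_succ]
  ring

lemma radial_deriv2 {d : ℕ} (hd : 2 ≤ d) (r : ℝ) :
    HasDerivAt (fun r : ℝ => bF ((d : ℝ) / 2) (r ^ 2)) (-(r / 2) * bF ((d : ℝ) / 2 + 1) (r ^ 2)) r := by
  have hd' : (2 : ℝ) ≤ d := by exact_mod_cast hd
  have ha : (1 : ℝ) ≤ (d : ℝ) / 2 := by linarith
  have := (bF_hasDerivAt ha (r ^ 2)).comp r (hasDerivAt_pow 2 r)
  refine (show HasDerivAt (fun r : ℝ => bF ((d : ℝ) / 2) (r ^ 2)) _ r from this).congr_deriv ?_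
  simp; ring

lemma bF_succ_nonneg {d : ℕ} (hd : 2 ≤ d) {j : ℝ} (hpos : ∀ r, 0 ≤ r → r < j → 0 < bF ((d : ℝ) / 2) (r ^ 2))
    {r : ℝ} (hr : 0 < r) (hrj : r ≤ j) : 0 ≤ bF ((d : ℝ) / 2 + 1) (r ^ 2) := by
  have hmono : MonotoneOn (fun r : ℝ => r ^ d * bF ((d : ℝ) / 2 + 1) (r ^ 2)) (Set.Icc 0 r) := by
    apply monotoneOn_of_deriv_nonneg (convex_Icc 0 r)
    · exact fun x _ => (radial_deriv hd x).continuousAt.continuousWithinAt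
    · exact fun x _ => (radial_deriv hd x).differentiableAt.differentiableWithinAt
    · intro x hx
      rw [interior_Icc] at hx
      rw [(radial_deriv hd x).deriv]
      have := hpos x hx.1.le (hx.2.trans_le hrj)
      have := hx.1
      positivity
  have := hmono (Set.left_mem_Icc.2 hr.le) (Set.right_mem_Icc.2 hr.le) hr.le
  simp only [zero_pow (by omega : d ≠ 0), zero_mul] at this
  exact nonneg_of_mul_nonneg_right this (by positivity)

/-- The one-dimensional radial inequality along a ray. -/
lemma radial_ineq {d : ℕ} (hd : 2 ≤ d) {j : ℝ} (hpos : ∀ r, 0 ≤ r → r < j → 0 < bF ((d : ℝ) / 2) (r ^ 2))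
    (hj : bF ((d : ℝ) / 2) (j ^ 2) = 0) {R : ℝ} (hR : 0 ≤ R) (hRj : R ≤ j) :
    ∫ r in (0 : ℝ)..R, r ^ (d - 1) * (((r / 2) * bF ((d : ℝ) / 2 + 1) (r ^ 2)) ^ 2 - bF ((d : ℝ) / 2) (r ^ 2) ^ 2) ≤ 0 := by
  have hd' : (2 : ℝ) ≤ d := by exact_mod_cast hd
  have ha : (1 : ℝ) ≤ (d : ℝ) / 2 := by linarith
  have hderiv : ∀ r : ℝ, HasDerivAt (fun r : ℝ => (-1 / 2) * ((r ^ d * bF ((d : ℝ) / 2 + 1) (r ^ 2)) * bF ((d : ℝ) / 2) (r ^ 2)))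
      (r ^ (d - 1) * (((r / 2) * bF ((d : ℝ) / 2 + 1) (r ^ 2)) ^ 2 - bF ((d : ℝ) / 2) (r ^ 2) ^ 2)) r := by
    intro r
    have := ((radial_deriv hd r).mul (radial_deriv2 hd r)).const_mul (-1 / 2)
    refine (show HasDerivAt (fun r : ℝ => (-1 / 2) * ((r ^ d * bF ((d : ℝ) / 2 + 1) (r ^ 2)) * bF ((d : ℝ) / 2) (r ^ 2))) _ r
      from this).congr_deriv ?_
    symm
    obtain ⟨k, rfl⟩ : ∃ k, d = k + 1 := ⟨d - 1, by omega⟩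
    rw [Nat.add_sub_cancel, pow_succ]
    ring
  have c1 := bF_continuous ha
  have c2 := bF_continuous (a := (d : ℝ) / 2 + 1) (by linarith)
  rw [intervalIntegral.integral_eq_sub_of_hasDerivAt (fun r _ => hderiv r) (Continuous.intervalIntegrable (by fun_prop) _ _)]
  simp only [zero_pow (by omega : d ≠ 0), zero_mul, mul_zero, sub_zero]
  rcases hR.eq_or_lt with rfl | hR'
  · simp [zero_pow (by omega : d ≠ 0)]
  · have h1 : 0 ≤ bF ((d : ℝ) / 2) (R ^ 2) := by
      rcases hRj.eq_or_lt with rfl | hRj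
      · exact hj.ge
      · exact (hpos R hR hRj).le
    have h2 := bF_succ_nonneg hd hpos hR' hRj
    have : 0 ≤ R ^ d * bF ((d : ℝ) / 2 + 1) (R ^ 2) * bF ((d : ℝ) / 2) (R ^ 2) := by positivity
    linarith

lemma polar_nonpos {d : ℕ} (hd : 0 < d) {F : Euc d → ℝ} (hF : Integrable F)
    (h : ∀ ω : Euc d, ‖ω‖ = 1 → ∫ r in Set.Ioi (0 : ℝ), r ^ (d - 1) * F (r • ω) ≤ 0) : ∫ x, F x ≤ 0 := by
  have : Nonempty (Fin d) := ⟨⟨0, hd⟩⟩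
  have : Nontrivial (Euc d) := by infer_instance
  set mp := (volume : Measure (Euc d)).measurePreserving_homeomorphUnitSphereProd
  set H := homeomorphUnitSphereProd (Euc d)
  have hms : MeasurableSet ({(0 : Euc d)}ᶜ : Set (Euc d)) := (measurableSet_singleton _).compl
  have e1 : ∫ x, F x = ∫ x : ({(0 : Euc d)}ᶜ : Set (Euc d)), F x ∂((volume : Measure (Euc d)).comap (↑)) := by
    rw [integral_subtype_comap hms F, restrict_compl_singleton]
  set G : Metric.sphere (0 : Euc d) 1 × Set.Ioi (0 : ℝ) → ℝ := fun p => F (p.2.1 • p.1.1) with hG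
  have hGH : ∀ x, G (H x) = F x := by
    intro x
    have h2 : (H.symm (H x)).1 = (H x).2.1 • (H x).1.1 := homeomorphUnitSphereProd_symm_apply_coe _ _
    rw [H.symm_apply_apply] at h2
    rw [hG]; dsimp only; rw [← h2]
  have hGi : Integrable G ((volume : Measure (Euc d)).toSphere.prod (Measure.volumeIoiPow (Module.finrank ℝ (Euc d) - 1))) := by
    rw [← mp.integrable_comp_emb H.measurableEmbedding]
    have : (G ∘ H) = fun x : ({(0 : Euc d)}ᶜ : Set (Euc d)) => F x := funext hGH
    change Integrable (G ∘ H) _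
    rw [this]
    have h3 : IntegrableOn F ({(0 : Euc d)}ᶜ) := hF.integrableOn
    rw [integrableOn_iff_comap_subtypeVal hms] at h3
    exact h3
  have e2 : ∫ x : ({(0 : Euc d)}ᶜ : Set (Euc d)), F x ∂((volume : Measure (Euc d)).comap (↑)) =
      ∫ p, G p ∂((volume : Measure (Euc d)).toSphere.prod (Measure.volumeIoiPow (Module.finrank ℝ (Euc d) - 1))) := by
    rw [← mp.integral_comp H.measurableEmbedding]
    exact integral_congr_ae (Eventually.of_forall fun x => (hGH x).symm)
  rw [e1, e2, integral_prod _ hGi]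
  apply integral_nonpos
  intro ω
  have hω : ‖(ω : Euc d)‖ = 1 := by simp
  have h4 := h ω hω
  have e3 : ∫ r, G (ω, r) ∂(Measure.volumeIoiPow (Module.finrank ℝ (Euc d) - 1)) =
      ∫ r in Set.Ioi (0 : ℝ), r ^ (d - 1) * F (r • (ω : Euc d)) := by
    rw [finrank_euclideanSpace_fin]
    simp only [Measure.volumeIoiPow, ENNReal.ofReal]
    rw [integral_withDensity_eq_integral_smul, hG,
        integral_subtype_comap measurableSet_Ioi fun a : ℝ ↦ Real.toNNReal (a ^ (d - 1)) • F (a • (ω : Euc d)),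
        setIntegral_congr_fun measurableSet_Ioi fun x hx ↦ ?_]
    · rw [NNReal.smul_def, Real.coe_toNNReal _ (pow_nonneg (Set.mem_Ioi.1 hx).le _), smul_eq_mul]
    · exact (measurable_subtype_coe.pow_const _).real_toNNReal
  exact e3.trans_le h4

lemma star_nonpos {d : ℕ} (hd : 0 < d) {S : Set (Euc d)} {x0 : Euc d} (hS : MeasurableSet S) {ρ : ℝ} (hρ : 0 ≤ ρ)
    (hSb : S ⊆ Metric.ball x0 ρ) (hstar : ∀ x ∈ S, ∀ t : ℝ, 0 < t → t ≤ 1 → x0 + t • (x - x0) ∈ S)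
    {h : ℝ → ℝ} (hc : Continuous h)
    (hneg : ∀ R, 0 ≤ R → R ≤ ρ → ∫ r in (0 : ℝ)..R, r ^ (d - 1) * h r ≤ 0) :
    ∫ x in S, h ‖x - x0‖ ≤ 0 := by
  rw [← integral_indicator hS]
  rw [← integral_add_right_eq_self _ x0]
  have hSbd : Bornology.IsBounded S := Metric.isBounded_ball.subset hSb
  apply polar_nonpos hd
  · have : Integrable (S.indicator fun x => h ‖x - x0‖) := by
      rw [integrable_indicator_iff hS]
      exact cont_intOn hSbd (by fun_prop)
    exact this.comp_add_right x0
  · intro ω hω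
    set I : Set ℝ := {r | 0 < r ∧ r • ω + x0 ∈ S} with hI
    have hIρ : ∀ r ∈ I, r < ρ := by
      rintro r ⟨hr, hrS⟩
      have := hSb hrS
      rw [Metric.mem_ball, dist_eq_norm, add_sub_cancel_right, norm_smul, hω, mul_one, Real.norm_eq_abs, abs_of_pos hr] at this
      exact this
    have hIdown : ∀ r ∈ I, ∀ s, 0 < s → s ≤ r → s ∈ I := by
      rintro r ⟨hr, hrS⟩ s hs hsr
      refine ⟨hs, ?_⟩
      have := hstar _ hrS (s / r) (by positivity) ((div_le_one hr).2 hsr)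
      rw [add_sub_cancel_right, smul_smul, div_mul_cancel₀ _ hr.ne'] at this
      rwa [add_comm]
    have hbdd : BddAbove I := ⟨ρ, fun r hr => (hIρ r hr).le⟩
    set R := sSup I with hR
    have hR0 : 0 ≤ R := Real.sSup_nonneg fun r hr => hr.1.le
    have hRρ : R ≤ ρ := Real.sSup_le (fun r hr => (hIρ r hr).le) hρ
    have hIiff : ∀ r, r ≠ R → (r ∈ I ↔ r ∈ Set.Ioc 0 R) := by
      intro r hr
      constructor
      · intro h; exact ⟨h.1, le_csSup hbdd h⟩
      · rintro ⟨h1, h2⟩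
        obtain ⟨s, hs, hrs⟩ := exists_lt_of_lt_csSup (by
          by_contra hne
          rw [Set.not_nonempty_iff_eq_empty] at hne
          rw [hR, hne, Real.sSup_empty] at h2
          linarith) (lt_of_le_of_ne h2 hr)
        exact hIdown s hs r h1 hrs.le
    have e : ∫ r in Set.Ioi (0 : ℝ), r ^ (d - 1) * (S.indicator (fun x => h ‖x - x0‖) (r • ω + x0)) =
        ∫ r in Set.Ioc 0 R, r ^ (d - 1) * h r := by
      rw [← integral_indicator measurableSet_Ioi, ← integral_indicator measurableSet_Ioc]
      apply integral_congr_ae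
      filter_upwards [(Set.countable_singleton R).ae_notMem volume] with r hr
      have hiff := hIiff r (by simpa using hr)
      by_cases hr0 : 0 < r
      · rw [Set.indicator_of_mem (Set.mem_Ioi.2 hr0)]
        by_cases hrS : r • ω + x0 ∈ S
        · rw [Set.indicator_of_mem hrS, Set.indicator_of_mem (hiff.1 ⟨hr0, hrS⟩), add_sub_cancel_right, norm_smul, hω, mul_one,
            Real.norm_eq_abs, abs_of_pos hr0]
        · rw [Set.indicator_of_notMem hrS, Set.indicator_of_notMem (fun h => hrS (hiff.2 h).2), mul_zero]
      · rw [Set.indicator_of_notMem (show r ∉ Set.Ioi 0 from hr0), Set.indicator_of_notMem (show r ∉ Set.Ioc 0 R from fun h => hr0 h.1)]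
    rw [e, ← intervalIntegral.integral_of_le hR0]
    exact hneg R hR0 hRρ

/-- Radial test function. -/
def radG (d : ℕ) (k : ℝ) (x0 x : Euc d) : ℝ := bF ((d : ℝ) / 2) (k ^ 2 * ‖x - x0‖ ^ 2)

lemma radG_contDiff {d : ℕ} (hd : 2 ≤ d) (k : ℝ) (x0 : Euc d) : ContDiff ℝ (⊤ : ℕ∞) (radG d k x0) := by
  have hd' : (2 : ℝ) ≤ d := by exact_mod_cast hd
  apply (bF_contDiff (a := (d : ℝ) / 2) (by linarith)).comp
  exact contDiff_const.mul ((contDiff_id.sub contDiff_const).norm_sq ℝ)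

lemma radG_fderiv {d : ℕ} (hd : 2 ≤ d) (k : ℝ) (x0 x : Euc d) :
    ‖fderiv ℝ (radG d k x0) x‖ ^ 2 = k ^ 2 * ((k * ‖x - x0‖ / 2) * bF ((d : ℝ) / 2 + 1) ((k * ‖x - x0‖) ^ 2)) ^ 2 := by
  have hd' : (2 : ℝ) ≤ d := by exact_mod_cast hd
  have h1 : HasFDerivAt (fun x : Euc d => k ^ 2 * ‖x - x0‖ ^ 2) ((k ^ 2) • ((2 : ℝ) • innerSL ℝ (x - x0))) x := by
    have := (((hasFDerivAt_id x).sub_const x0).norm_sq).const_mul (k ^ 2)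
    have e : (2 : ℝ) • innerSL ℝ (x - x0) = (2 : ℕ) • innerSL ℝ (x - x0) := by
      rw [two_smul, two_smul]
    rw [e]
    simpa using this
  have h2 := (bF_hasDerivAt (a := (d : ℝ) / 2) (by linarith) (k ^ 2 * ‖x - x0‖ ^ 2)).comp_hasFDerivAt x h1
  have h3 : fderiv ℝ (radG d k x0) x = _ := HasFDerivAt.fderiv h2
  rw [h3, norm_smul, norm_smul, norm_smul, innerSL_apply_norm, mul_pow k, Real.norm_eq_abs, Real.norm_eq_abs, Real.norm_eq_abs]
  simp only [mul_pow, sq_abs]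
  ring

lemma radG_ineq {d : ℕ} (hd : 2 ≤ d) {j : ℝ} (hpos : ∀ r, 0 ≤ r → r < j → 0 < bF ((d : ℝ) / 2) (r ^ 2))
    (hj : bF ((d : ℝ) / 2) (j ^ 2) = 0) {S : Set (Euc d)} {x0 : Euc d} (hS : MeasurableSet S) {ρ k : ℝ} (hρ : 0 < ρ)
    (hk : 0 < k) (hkρ : k * ρ = j)
    (hSb : S ⊆ Metric.ball x0 ρ) (hstar : ∀ x ∈ S, ∀ t : ℝ, 0 < t → t ≤ 1 → x0 + t • (x - x0) ∈ S) :
    ∫ x in S, ‖fderiv ℝ (radG d k x0) x‖ ^ 2 ≤ k ^ 2 * ∫ x in S, radG d k x0 x ^ 2 := by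
  have hd' : (2 : ℝ) ≤ d := by exact_mod_cast hd
  have c1 := bF_continuous (a := (d : ℝ) / 2) (by linarith)
  have c2 := bF_continuous (a := (d : ℝ) / 2 + 1) (by linarith)
  have hSbd : Bornology.IsBounded S := Metric.isBounded_ball.subset hSb
  have hg := radG_contDiff hd k x0
  have hgc : Continuous (radG d k x0) := hg.continuous
  have hgf : Continuous (fderiv ℝ (radG d k x0)) := hg.continuous_fderiv (by simp)
  have i1 : IntegrableOn (fun x => ‖fderiv ℝ (radG d k x0) x‖ ^ 2) S := cont_intOn hSbd (by fun_prop)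
  have i2 : IntegrableOn (fun x => k ^ 2 * radG d k x0 x ^ 2) S := cont_intOn hSbd (by fun_prop)
  rw [← sub_nonpos, ← integral_const_mul, ← integral_sub i1 i2]
  set f : ℝ → ℝ := fun r => ((r / 2) * bF ((d : ℝ) / 2 + 1) (r ^ 2)) ^ 2 - bF ((d : ℝ) / 2) (r ^ 2) ^ 2 with hf
  have hfc : Continuous f := by fun_prop
  have key := star_nonpos (by omega : 0 < d) hS hρ.le hSb hstar (h := fun r => k ^ 2 * f (k * r)) (by fun_prop) (by
    intro R hR hRρ
    have h1 := radial_ineq hd hpos hj (R := k * R) (by positivity) (by rw [← hkρ]; gcongr)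
    have h2 : ∫ r in (0 : ℝ)..R, r ^ (d - 1) * (k ^ 2 * f (k * r)) =
        (k ^ 2 / k ^ (d - 1)) * ∫ r in (0 : ℝ)..R, (fun s => s ^ (d - 1) * f s) (k * r) := by
      rw [← intervalIntegral.integral_const_mul]
      congr 1
      ext r
      dsimp only
      rw [mul_pow]
      field_simp
    have h4 := intervalIntegral.integral_comp_mul_left (a := 0) (b := R) (fun s => s ^ (d - 1) * f s) hk.ne'
    rw [mul_zero] at h4
    rw [h2, h4]
    have h3 : (∫ s in (0 : ℝ)..(k * R), s ^ (d - 1) * f s) ≤ 0 := h1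
    apply mul_nonpos_of_nonneg_of_nonpos (by positivity)
    exact smul_nonpos_of_nonneg_of_nonpos (by positivity) h3)
  refine le_trans (le_of_eq ?_) key
  apply setIntegral_congr_fun hS
  intro x hx
  dsimp only
  rw [radG_fderiv hd, hf, radG]
  dsimp only
  rw [mul_pow k ‖x - x0‖]
  ring

/-- One-dimensional cutoff profile. -/
def cG (y : ℝ) : ℝ := y * Real.smoothTransition (y - 1)

lemma cG_contDiff : ContDiff ℝ (⊤ : ℕ∞) cG :=
  contDiff_id.mul (Real.smoothTransition.contDiff.comp (contDiff_id.sub contDiff_const))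

lemma cG_zero {y : ℝ} (hy : y ≤ 1) : cG y = 0 := by
  rw [cG, Real.smoothTransition.zero_of_nonpos (by linarith), mul_zero]

lemma cG_one {y : ℝ} (hy : 2 ≤ y) : cG y = y := by
  rw [cG, Real.smoothTransition.one_of_one_le (by linarith), mul_one]

lemma cG_abs (y : ℝ) : |cG y| ≤ |y| := by
  rw [cG, abs_mul, abs_of_nonneg (Real.smoothTransition.nonneg _)]
  exact mul_le_of_le_one_right (abs_nonneg _) (Real.smoothTransition.le_one _)

lemma cG_deriv_one {y : ℝ} (hy : 2 < y) : deriv cG y = 1 := by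
  have : cG =ᶠ[nhds y] id := by
    filter_upwards [lt_mem_nhds hy] with z hz
    exact cG_one hz.le
  rw [this.deriv_eq, deriv_id]

lemma cG_deriv_zero {y : ℝ} (hy : y < 1) : deriv cG y = 0 := by
  have : cG =ᶠ[nhds y] fun _ => 0 := by
    filter_upwards [gt_mem_nhds hy] with z hz
    exact cG_zero (le_of_lt hz)
  rw [this.deriv_eq, deriv_const]

lemma cG_deriv_bdd : ∃ M : ℝ, ∀ y, |deriv cG y| ≤ M := by
  have hc : Continuous (deriv cG) := cG_contDiff.continuous_deriv (by simp)
  obtain ⟨C, hC⟩ := (isCompact_Icc (a := (1 : ℝ)) (b := 2)).exists_bound_of_continuousOn hc.continuousOn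
  refine ⟨max C 1, fun y => ?_⟩
  rcases lt_or_ge y 1 with h | h
  · rw [cG_deriv_zero h]; simp
  rcases lt_or_ge 2 y with h' | h'
  · rw [cG_deriv_one h']; simp
  · exact (hC y ⟨h, h'⟩).trans (le_max_left _ _)

open Classical in
/-- Cut off version of `g` in the ball. -/
def cutF {d : ℕ} (g : Euc d → ℝ) (x0 : Euc d) (ρ ε : ℝ) (x : Euc d) : ℝ :=
  if x ∈ Metric.ball x0 ρ then ε * cG (g x / ε) else 0

lemma cutF_out {d : ℕ} {g : Euc d → ℝ} (hg : Continuous g) {x0 : Euc d} {ρ ε : ℝ} (hε : 0 < ε)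
    (hs : ∀ x, dist x x0 = ρ → g x = 0) {x : Euc d} (hx : x ∉ Metric.ball x0 ρ) :
    cutF g x0 ρ ε =ᶠ[nhds x] fun _ => 0 := by
  rw [Metric.mem_ball, not_lt] at hx
  rcases hx.lt_or_eq with h | h
  · have : ∀ᶠ y in nhds x, ρ < dist y x0 :=
      (continuous_id.dist continuous_const).continuousAt.eventually (lt_mem_nhds h)
    filter_upwards [this] with y hy
    rw [cutF, if_neg]
    rw [Metric.mem_ball, not_lt]; exact hy.le
  · have : ∀ᶠ y in nhds x, g y < ε :=
      hg.continuousAt.eventually (gt_mem_nhds (by rw [hs x h.symm]; exact hε))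
    filter_upwards [this] with y hy
    rw [cutF, cG_zero ((div_le_one hε).2 hy.le)]
    simp

lemma cutF_in {d : ℕ} {g : Euc d → ℝ} {x0 : Euc d} {ρ ε : ℝ}
    {x : Euc d} (hx : x ∈ Metric.ball x0 ρ) :
    cutF g x0 ρ ε =ᶠ[nhds x] fun x => ε * cG (g x / ε) := by
  filter_upwards [Metric.isOpen_ball.mem_nhds hx] with y hy
  rw [cutF, if_pos hy]

lemma cutF_contDiff {d : ℕ} {g : Euc d → ℝ} (hg : ContDiff ℝ (⊤ : ℕ∞) g) {x0 : Euc d} {ρ ε : ℝ} (hε : 0 < ε)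
    (hs : ∀ x, dist x x0 = ρ → g x = 0) : ContDiff ℝ (⊤ : ℕ∞) (cutF g x0 ρ ε) := by
  rw [contDiff_iff_contDiffAt]
  intro x
  by_cases hx : x ∈ Metric.ball x0 ρ
  · refine ContDiffAt.congr_of_eventuallyEq ?_ (cutF_in hx)
    exact (contDiff_const.mul (cG_contDiff.comp (hg.div_const ε))).contDiffAt
  · exact ContDiffAt.congr_of_eventuallyEq contDiffAt_const (cutF_out hg.continuous hε hs hx)

lemma cutF_zero {d : ℕ} {g : Euc d → ℝ} {x0 : Euc d} {ρ ε : ℝ}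
    {x : Euc d} (hx : x ∉ Metric.ball x0 ρ) : cutF g x0 ρ ε x = 0 := by
  rw [cutF, if_neg hx]

lemma cutF_fderiv_zero {d : ℕ} {g : Euc d → ℝ} (hg : Continuous g) {x0 : Euc d} {ρ ε : ℝ} (hε : 0 < ε)
    (hs : ∀ x, dist x x0 = ρ → g x = 0) {x : Euc d} (hx : x ∉ Metric.ball x0 ρ) :
    fderiv ℝ (cutF g x0 ρ ε) x = 0 := by
  rw [(cutF_out hg hε hs hx).fderiv_eq]; simp

lemma cutF_fderiv {d : ℕ} {g : Euc d → ℝ} (hg : ContDiff ℝ (⊤ : ℕ∞) g) {x0 : Euc d} {ρ ε : ℝ} (hε : 0 < ε)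
    {x : Euc d} (hx : x ∈ Metric.ball x0 ρ) :
    fderiv ℝ (cutF g x0 ρ ε) x = deriv cG (g x / ε) • fderiv ℝ g x := by
  rw [(cutF_in hx).fderiv_eq]
  have h1 : HasFDerivAt g (fderiv ℝ g x) x := (hg.differentiable (by simp) x).hasFDerivAt
  have h2 : HasDerivAt cG (deriv cG (g x / ε)) (g x / ε) := (cG_contDiff.differentiable (by simp) _).hasDerivAt
  have h3 : HasFDerivAt (fun x => g x / ε) (ε⁻¹ • fderiv ℝ g x) x := by
    have := h1.const_mul ε⁻¹
    refine HasFDerivAt.congr_of_eventuallyEq this (Eventually.of_forall fun y => ?_)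
    simp only [div_eq_inv_mul]
  have h4 := (h2.comp_hasFDerivAt x h3).const_mul ε
  have h5 : fderiv ℝ (fun x => ε * cG (g x / ε)) x = _ := HasFDerivAt.fderiv h4
  rw [h5, smul_smul, smul_smul]
  congr 1
  field_simp

lemma exists_test {d : ℕ} {g : Euc d → ℝ} (hg : ContDiff ℝ (⊤ : ℕ∞) g) {x0 : Euc d} {ρ c c' : ℝ}
    (hs : ∀ x, dist x x0 = ρ → g x = 0) (hgp : ∀ x ∈ Metric.ball x0 ρ, 0 < g x) {Ω : Set (Euc d)}
    (ho : IsOpen Ω) (hb : Bornology.IsBounded Ω)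
    (hA : 0 < ∫ x in Ω ∩ Metric.ball x0 ρ, g x ^ 2)
    (hB : ∫ x in Ω ∩ Metric.ball x0 ρ, ‖fderiv ℝ g x‖ ^ 2 ≤ c * ∫ x in Ω ∩ Metric.ball x0 ρ, g x ^ 2)
    (hc : c < c') :
    ∃ ψ : Euc d → ℝ, ContDiff ℝ (⊤ : ℕ∞) ψ ∧ (∀ x, x ∉ Metric.ball x0 ρ → ψ x = 0) ∧
      (∀ x, x ∉ Metric.ball x0 ρ → fderiv ℝ ψ x = 0) ∧ (0 < ∫ x in Ω, ψ x ^ 2) ∧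
      ∫ x in Ω, ‖fderiv ℝ ψ x‖ ^ 2 ≤ c' * ∫ x in Ω, ψ x ^ 2 := by
  set S := Ω ∩ Metric.ball x0 ρ with hS
  have hSo : IsOpen S := ho.inter Metric.isOpen_ball
  have hSb : Bornology.IsBounded S := hb.subset Set.inter_subset_left
  have hgc := hg.continuous
  have hgf : Continuous (fderiv ℝ g) := hg.continuous_fderiv (by simp)
  obtain ⟨M, hM⟩ := cG_deriv_bdd
  set e : ℕ → ℝ := fun n => 1 / ((n : ℝ) + 1) with he
  have hep : ∀ n, 0 < e n := fun n => by positivity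
  have hel : Tendsto e atTop (nhds 0) := tendsto_one_div_add_atTop_nhds_zero_nat
  have hev : ∀ x ∈ S, ∀ᶠ n in atTop, 2 < g x / e n := by
    intro x hx
    have hp := hgp x hx.2
    filter_upwards [hel.eventually (gt_mem_nhds (show 0 < g x / 2 by positivity))] with n hn
    rw [lt_div_iff₀ (hep n)]; linarith
  have hcd : ∀ n, ContDiff ℝ (⊤ : ℕ∞) (cutF g x0 ρ (e n)) := fun n => cutF_contDiff hg (hep n) hs
  have hcc : ∀ n, Continuous (cutF g x0 ρ (e n)) := fun n => (hcd n).continuous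
  have hcf : ∀ n, Continuous (fderiv ℝ (cutF g x0 ρ (e n))) := fun n => (hcd n).continuous_fderiv (by simp)
  have tA : Tendsto (fun n => ∫ x in S, cutF g x0 ρ (e n) x ^ 2) atTop (nhds (∫ x in S, g x ^ 2)) := by
    apply tendsto_integral_of_dominated_convergence (fun x => g x ^ 2)
    · intro n
      exact ((hcc n).pow 2).aestronglyMeasurable
    · exact cont_intOn hSb (by fun_prop)
    · intro n
      filter_upwards [ae_restrict_mem hSo.measurableSet] with x hx
      rw [Real.norm_eq_abs, abs_of_nonneg (sq_nonneg _), cutF, if_pos hx.2]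
      apply sq_le_sq.2
      have h1 := cG_abs (g x / e n)
      rw [abs_mul, abs_of_pos (hep n)]
      rw [abs_div, abs_of_pos (hep n), le_div_iff₀ (hep n)] at h1
      linarith
    · filter_upwards [ae_restrict_mem hSo.measurableSet] with x hx
      apply tendsto_const_nhds.congr'
      filter_upwards [hev x hx] with n hn
      rw [cutF, if_pos hx.2, cG_one hn.le, mul_div_cancel₀ _ (hep n).ne']
  have tB : Tendsto (fun n => ∫ x in S, ‖fderiv ℝ (cutF g x0 ρ (e n)) x‖ ^ 2) atTop (nhds (∫ x in S, ‖fderiv ℝ g x‖ ^ 2)) := by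
    apply tendsto_integral_of_dominated_convergence (fun x => M ^ 2 * ‖fderiv ℝ g x‖ ^ 2)
    · intro n
      exact ((hcf n).norm.pow 2).aestronglyMeasurable
    · exact cont_intOn hSb (by fun_prop)
    · intro n
      filter_upwards [ae_restrict_mem hSo.measurableSet] with x hx
      rw [Real.norm_eq_abs, abs_of_nonneg (sq_nonneg _), cutF_fderiv hg (hep n) hx.2, norm_smul, mul_pow, Real.norm_eq_abs]
      gcongr
      exact hM _
    · filter_upwards [ae_restrict_mem hSo.measurableSet] with x hx
      apply tendsto_const_nhds.congr'
      filter_upwards [hev x hx] with n hn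
      rw [cutF_fderiv hg (hep n) hx.2, cG_deriv_one hn, one_smul]
  have eA := tA.eventually (lt_mem_nhds hA)
  have tC := tB.sub (tA.const_mul c')
  have eC := tC.eventually (gt_mem_nhds (show _ < (0 : ℝ) by nlinarith))
  obtain ⟨n, h1, h2⟩ := (eA.and eC).exists
  have r1 : ∫ x in Ω, cutF g x0 ρ (e n) x ^ 2 = ∫ x in S, cutF g x0 ρ (e n) x ^ 2 := by
    apply setIntegral_eq_of_subset_of_forall_sdiff_eq_zero ho.measurableSet Set.inter_subset_left
    intro x hx
    rw [cutF_zero (fun h => hx.2 ⟨hx.1, h⟩)]; simp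
  have r2 : ∫ x in Ω, ‖fderiv ℝ (cutF g x0 ρ (e n)) x‖ ^ 2 = ∫ x in S, ‖fderiv ℝ (cutF g x0 ρ (e n)) x‖ ^ 2 := by
    apply setIntegral_eq_of_subset_of_forall_sdiff_eq_zero ho.measurableSet Set.inter_subset_left
    intro x hx
    rw [cutF_fderiv_zero hgc (hep n) hs (fun h => hx.2 ⟨hx.1, h⟩)]; simp
  refine ⟨cutF g x0 ρ (e n), hcd n, fun x => cutF_zero, fun x => cutF_fderiv_zero hgc (hep n) hs, ?_, ?_⟩
  · rw [r1]; exact h1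
  · rw [r1, r2]; linarith

lemma exists_bessel_test {d : ℕ} (hd : 2 ≤ d) {j : ℝ} (hpos : ∀ r, 0 ≤ r → r < j → 0 < bF ((d : ℝ) / 2) (r ^ 2))
    (hj : bF ((d : ℝ) / 2) (j ^ 2) = 0) {Ω : Set (Euc d)} (hΩ : IsConvexDomain Ω) {x0 : Euc d} (hx0 : x0 ∈ Ω)
    {ρ k c' : ℝ} (hρ : 0 < ρ) (hk : 0 < k) (hkρ : k * ρ = j) (hc : k ^ 2 < c') :
    ∃ ψ : Euc d → ℝ, ContDiff ℝ (⊤ : ℕ∞) ψ ∧ (∀ x, x ∉ Metric.ball x0 ρ → ψ x = 0) ∧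
      (∀ x, x ∉ Metric.ball x0 ρ → fderiv ℝ ψ x = 0) ∧ (0 < ∫ x in Ω, ψ x ^ 2) ∧
      ∫ x in Ω, ‖fderiv ℝ ψ x‖ ^ 2 ≤ c' * ∫ x in Ω, ψ x ^ 2 := by
  obtain ⟨-, ho, hb, hconv⟩ := hΩ
  have hball : Convex ℝ (Ω ∩ Metric.ball x0 ρ) := hconv.inter (convex_ball x0 ρ)
  have hx0S : x0 ∈ Ω ∩ Metric.ball x0 ρ := ⟨hx0, Metric.mem_ball_self hρ⟩
  have hgp : ∀ x ∈ Metric.ball x0 ρ, 0 < radG d k x0 x := by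
    intro x hx
    rw [Metric.mem_ball, dist_eq_norm] at hx
    rw [radG, ← mul_pow]
    apply hpos _ (by positivity)
    rw [← hkρ]; gcongr
  have hso : IsOpen (Ω ∩ Metric.ball x0 ρ) := ho.inter Metric.isOpen_ball
  refine exists_test (radG_contDiff hd k x0) (c := k ^ 2) ?_ hgp ho hb ?_ ?_ hc
  · intro x hx
    rw [dist_eq_norm] at hx
    rw [radG, ← mul_pow, hx, hkρ, hj]
  · apply sq_int_pos hso (hb.subset Set.inter_subset_left) (radG_contDiff hd k x0).continuous
    intro h
    exact (hgp x0 hx0S.2).ne' (h x0 hx0S)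
  · apply radG_ineq hd hpos hj hso.measurableSet hρ hk hkρ Set.inter_subset_right
    intro x hx t ht ht1
    exact hball.add_smul_sub_mem hx0S hx ⟨ht.le, ht1⟩

lemma neumann_upper {d : ℕ} (hd : 2 ≤ d) {j : ℝ} (hj0 : 0 < j) (hpos : ∀ r, 0 ≤ r → r < j → 0 < bF ((d : ℝ) / 2) (r ^ 2))
    (hj : bF ((d : ℝ) / 2) (j ^ 2) = 0) {Ω : Set (Euc d)} (hΩ : IsConvexDomain Ω) {x0 x1 : Euc d} (hx0 : x0 ∈ Ω)
    (hx1 : x1 ∈ Ω) (hne : x0 ≠ x1) : neumannEigenvalue 1 Ω ≤ (2 * j / dist x0 x1) ^ 2 := by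
  have hD : 0 < dist x0 x1 := dist_pos.2 hne
  set ρ := dist x0 x1 / 2 with hρd
  have hρ : 0 < ρ := by positivity
  have hkρ : 2 * j / dist x0 x1 * ρ = j := by rw [hρd]; field_simp
  have hk : 0 < 2 * j / dist x0 x1 := by positivity
  set k := 2 * j / dist x0 x1
  apply le_of_forall_gt_imp_ge_of_dense
  intro c' hc'
  obtain ⟨ψ, s0, z0, f0, p0, q0⟩ := exists_bessel_test hd hpos hj hΩ hx0 hρ hk hkρ hc'
  obtain ⟨φ, s1, z1, f1, p1, q1⟩ := exists_bessel_test hd hpos hj hΩ hx1 hρ hk hkρ hc'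
  have hdis : ∀ x, x ∉ Metric.ball x0 ρ ∨ x ∉ Metric.ball x1 ρ := by
    intro x
    by_contra h
    push Not at h
    have h1 := h.1
    have h2 := h.2
    rw [Metric.mem_ball] at h1 h2
    have := dist_triangle_left x0 x1 x
    linarith
  have hzz : ∀ x, ψ x * φ x = 0 := by
    intro x
    rcases hdis x with h | h
    · rw [z0 x h, zero_mul]
    · rw [z1 x h, mul_zero]
  obtain ⟨-, ho, hb, -⟩ := hΩ
  have c0 := s0.continuous
  have c1 := s1.continuous
  have cf0 : Continuous (fderiv ℝ ψ) := s0.continuous_fderiv (by simp)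
  have cf1 : Continuous (fderiv ℝ φ) := s1.continuous_fderiv (by simp)
  have hsq : ∀ a b : ℝ, ∫ x in Ω, (a * ψ x + b * φ x) ^ 2 = a ^ 2 * (∫ x in Ω, ψ x ^ 2) + b ^ 2 * ∫ x in Ω, φ x ^ 2 := by
    intro a b
    rw [quad_int hb c0 c1]
    simp [hzz]
  have hgr : ∀ a b : ℝ, ∫ x in Ω, ‖fderiv ℝ (a • ψ + b • φ) x‖ ^ 2 =
      a ^ 2 * (∫ x in Ω, ‖fderiv ℝ ψ x‖ ^ 2) + b ^ 2 * ∫ x in Ω, ‖fderiv ℝ φ x‖ ^ 2 := by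
    intro a b
    have i1 : IntegrableOn (fun x => a ^ 2 * ‖fderiv ℝ ψ x‖ ^ 2) Ω := cont_intOn hb (by fun_prop)
    have i2 : IntegrableOn (fun x => b ^ 2 * ‖fderiv ℝ φ x‖ ^ 2) Ω := cont_intOn hb (by fun_prop)
    rw [← integral_const_mul, ← integral_const_mul, ← integral_add i1 i2]
    congr 1
    ext x
    have d0 := (s0.differentiable (by simp) x).hasFDerivAt
    have d1 := (s1.differentiable (by simp) x).hasFDerivAt
    have hdd : fderiv ℝ (a • ψ + b • φ) x = _ := ((d0.const_smul a).add (d1.const_smul b)).fderiv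
    rw [hdd]
    rcases hdis x with h | h
    · rw [f0 x h]; simp [norm_smul, mul_pow]
    · rw [f1 x h]; simp [norm_smul, mul_pow]
  have hV := span_pair_prop (Ω := Ω) s0 s1 (by
    intro a b hab
    have h0 : ∫ x in Ω, (a * ψ x + b * φ x) ^ 2 = 0 := by
      rw [setIntegral_congr_fun ho.measurableSet (g := fun _ => (0 : ℝ)) (fun x hx => by simp [hab x hx])]
      simp
    rw [hsq] at h0
    have t1 : 0 ≤ a ^ 2 * (∫ x in Ω, ψ x ^ 2) := by positivity
    have t2 : 0 ≤ b ^ 2 * (∫ x in Ω, φ x ^ 2) := by positivity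
    have t3 : a ^ 2 * (∫ x in Ω, ψ x ^ 2) = 0 := by linarith
    have t4 : b ^ 2 * (∫ x in Ω, φ x ^ 2) = 0 := by linarith
    constructor
    · simpa [p0.ne'] using t3
    · simpa [p1.ne'] using t4)
  have hle : neumannEigenvalue 1 Ω ≤
      sSup { r : ℝ | ∃ u ∈ Submodule.span ℝ {ψ, φ}, (0 < ∫ x in Ω, (u x) ^ 2) ∧ r = rayleigh Ω u } := by
    apply csInf_le
    · refine ⟨0, ?_⟩
      rintro r ⟨V, -, -, rfl⟩
      exact rsup_nonneg Ω V
    · exact ⟨_, hV.1, hV.2, rfl⟩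
  refine hle.trans (Real.sSup_le ?_ ((sq_nonneg k).trans hc'.le))
  rintro r ⟨u, hu, hup, rfl⟩
  obtain ⟨a, b, rfl⟩ := Submodule.mem_span_pair.1 hu
  rw [rayleigh, div_le_iff₀ hup, hgr]
  have e : ∫ x in Ω, ((a • ψ + b • φ) x) ^ 2 = ∫ x in Ω, (a * ψ x + b * φ x) ^ 2 := rfl
  rw [e, hsq]
  have t1 := mul_le_mul_of_nonneg_left q0 (sq_nonneg a)
  have t2 := mul_le_mul_of_nonneg_left q1 (sq_nonneg b)
  linarith

/-- sharp quasi-monotonicity of the first nontrivial Neumann eigenvalue for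
nested bounded convex domains, with constant `π²/(4 j_{d/2-1,1}²)`. -/
theorem first_eigenvalue_quasi_monotonicity
    (d : ℕ) (hd : 2 ≤ d) (Ω₁ Ω₂ : Set (Euc d))
    (h₁ : IsConvexDomain Ω₁) (h₂ : IsConvexDomain Ω₂) (hsub : Ω₁ ⊆ Ω₂) :
    neumannEigenvalue 1 Ω₁ ≥
      Real.pi ^ 2 / (4 * besselZero1 ((d : ℝ) / 2 - 1) ^ 2) * neumannEigenvalue 1 Ω₂ := by
  have hd' : (2 : ℝ) ≤ d := by exact_mod_cast hd
  have hjn : 0 ≤ besselZero1 ((d : ℝ) / 2 - 1) := Real.sInf_nonneg fun x hx => hx.1.le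
  have m1 := neumann_nonneg 1 Ω₁
  have m2 := neumann_nonneg 1 Ω₂
  rcases hjn.eq_or_lt with hj0 | hj0
  · rw [← hj0]; simpa using m1
  rcases m2.eq_or_lt with hm | hm
  · rw [← hm]; simpa using m1
  obtain ⟨hz, hpos⟩ := bessel_facts (a := (d : ℝ) / 2) (by linarith) rfl hj0
  set j := besselZero1 ((d : ℝ) / 2 - 1)
  set μ := neumannEigenvalue 1 Ω₂
  have hs : 0 < √μ := Real.sqrt_pos.2 hm
  have hD := neumann_lower_diam (by omega : 0 < d) h₁ (D := 2 * j / √μ) (by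
    intro x hx y hy
    by_cases hxy : x = y
    · rw [hxy, dist_self]; positivity
    · have hdist : 0 < dist x y := dist_pos.2 hxy
      have h := neumann_upper hd hj0 hpos hz h₂ (hsub hx) (hsub hy) hxy
      have h' : √μ ≤ 2 * j / dist x y := Real.sqrt_le_iff.2 ⟨by positivity, h⟩
      rw [le_div_iff₀ hdist] at h'
      rw [le_div_iff₀ hs]
      linarith)
  refine ge_iff_le.2 (le_trans (le_of_eq ?_) hD)
  have hsq : μ = √μ ^ 2 := (Real.sq_sqrt m2).symm
  rw [hsq, Real.sqrt_sq hs.le]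
  field_simp
  try ring

end
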